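/- arXiv:1709.07975 — 8 statements merged into one kernel-verified Lean document; each statement's English description precedes it below -/
import Mathlib

section
/- Let a and b be vertices of a finite simple graph X with adjacency matrix A, and for a vertex u let M_u denote the walk matrix whose columns are e_u, A e_u, …, A^{n−1} e_u (n = |V|). The following are equivalent: (i) a and b are cospectral, i.e., the characteristic polynomial of the principal submatrix of A obtained by deleting the row and column of a equals that obtained by deleting the row and column of b; (ii) for every spectral idempotent E_r, (E_r)_{a,a} = (E_r)_{b,b}; (iii) for every non-negative integer k, (A^k)_{a,a} = (A^k)_{b,b}; (iv) M_a^T M_a = M_b^T M_b; (v) for all non-negative integers k, (e_a − e_b)^T A^k (e_a + e_b) = 0 (i.e., the A-invariant subspaces of ℝ^V generated by e_a − e_b and by e_a + e_b are orthogonal). -/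
open Matrix BigOperators

/-- A spectral decomposition of a real symmetric matrix `A`: the `θ r` are the distinct
eigenvalues and `E r` is the orthogonal projection onto the `θ r`-eigenspace. -/
structure IsSpectralDecomp {V : Type*} [Fintype V] [DecidableEq V] (A : Matrix V V ℝ)
    {m : ℕ} (θ : Fin m → ℝ) (E : Fin m → Matrix V V ℝ) : Prop where
  theta_inj : Function.Injective θ
  symm : ∀ r, (E r)ᵀ = E r
  idem : ∀ r, E r * E r = E r
  mul_eq_zero : ∀ r s, r ≠ s → E r * E s = 0
  sum_eq_one : ∑ r, E r = 1
  eq_sum : A = ∑ r, θ r • E r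
  ne_zero : ∀ r, E r ≠ 0

namespace Matrix

variable {V : Type*} [Fintype V] [DecidableEq V]

/-- A diagonal entry of the adjugate is the determinant of the principal submatrix obtained by
deleting the corresponding row and column. -/
theorem adjugate_apply_self_eq_det_submatrix {R : Type*} [CommRing R] (M : Matrix V V R) (a : V) :
    M.adjugate a a =
      (M.submatrix (fun i : {x : V // x ≠ a} => (i : V))
        (fun i : {x : V // x ≠ a} => (i : V))).det := by
  rw [adjugate_apply, twoBlockTriangular_det _ (fun x => x ≠ a)]
  · have h₁ : (toSquareBlockProp (M.updateRow a (Pi.single a 1)) fun x => x ≠ a) =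
        M.submatrix (fun i : {x : V // x ≠ a} => (i : V))
          (fun i : {x : V // x ≠ a} => (i : V)) := by
      ext i j
      simp [toSquareBlockProp, updateRow_ne i.2]
    have h₂ : (toSquareBlockProp (M.updateRow a (Pi.single a 1)) fun x => ¬ x ≠ a) = 1 := by
      ext ⟨i, hi⟩ ⟨j, hj⟩
      obtain rfl := not_not.mp hi
      obtain rfl := not_not.mp hj
      simp [toSquareBlockProp]
    rw [h₁, h₂, det_one, mul_one]
  · intro i hi j hj
    obtain rfl := not_not.mp hi
    simp [Pi.single_eq_of_ne hj]

theorem charpoly_submatrix_ne_eq_adjugate {R : Type*} [CommRing R] (A : Matrix V V R) (a : V) :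
    (A.submatrix (fun i : {x : V // x ≠ a} => (i : V))
      (fun i : {x : V // x ≠ a} => (i : V))).charpoly = A.charmatrix.adjugate a a := by
  rw [adjugate_apply_self_eq_det_submatrix, charpoly]
  congr 1
  ext1 i j
  simp [charmatrix_apply, diagonal_apply, Subtype.ext_iff]

/-- By Cayley–Hamilton, diagonal entries of all powers agree once those of the powers below the
order of the matrix do. -/
theorem forall_pow_apply_self_eq_of_lt_card {R : Type*} [CommRing R] {A : Matrix V V R} {a b : V}
    (h : ∀ k < Fintype.card V, (A ^ k) a a = (A ^ k) b b) (k : ℕ) :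
    (A ^ k) a a = (A ^ k) b b := by
  nontriviality R
  have hdeg : (Polynomial.X ^ k %ₘ A.charpoly).degree < (Fintype.card V : ℕ) := by
    rw [← A.charpoly_degree_eq_dim]
    exact Polynomial.degree_modByMonic_lt _ A.charpoly_monic
  rw [A.pow_eq_aeval_mod_charpoly k, Polynomial.aeval_eq_sum_range]
  simp only [sum_apply, smul_apply]
  refine Finset.sum_congr rfl fun i _ => ?_
  by_cases hi : i < Fintype.card V
  · rw [h i hi]
  · rw [Polynomial.coeff_eq_zero_of_degree_lt
      (hdeg.trans_le (by exact_mod_cast not_lt.mp hi)), zero_smul, zero_smul]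

/-- The entries of the Gram matrix of the walk matrix at `u` count closed walks at `u`. -/
theorem IsSymm.walk_gram_apply {R : Type*} [CommRing R] {A : Matrix V V R} (hA : A.IsSymm)
    {n : ℕ} (u : V) (i j : Fin n) :
    ((of fun v (j : Fin n) => (A ^ (j : ℕ)) v u)ᵀ * (of fun v (j : Fin n) => (A ^ (j : ℕ)) v u))
      i j = (A ^ ((i : ℕ) + (j : ℕ))) u u := by
  rw [pow_add, mul_apply, mul_apply]
  refine Finset.sum_congr rfl fun v _ => ?_
  simp only [transpose_apply, of_apply]
  rw [(hA.pow i).apply]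

theorem IsSymm.sub_dotProduct_mulVec_add {R : Type*} [CommRing R] {B : Matrix V V R}
    (hB : B.IsSymm) (a b : V) :
    (Pi.single a (1 : R) - Pi.single b 1) ⬝ᵥ (B *ᵥ (Pi.single a 1 + Pi.single b 1)) =
      B a a - B b b := by
  simp only [mulVec_add, sub_dotProduct, dotProduct_add, mulVec_single_one, single_one_dotProduct,
    col_apply, hB.apply a b]
  ring

end Matrix

namespace IsSpectralDecomp

open Polynomial

variable {V : Type*} [Fintype V] [DecidableEq V] {A : Matrix V V ℝ} {m : ℕ} {θ : Fin m → ℝ}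
  {E : Fin m → Matrix V V ℝ}

theorem idempotent_mul (h : IsSpectralDecomp A θ E) (r : Fin m) : E r * A = θ r • E r := by
  rw [h.eq_sum, Finset.mul_sum, Finset.sum_eq_single r]
  · rw [mul_smul_comm, h.idem]
  · intro s _ hs
    rw [mul_smul_comm, h.mul_eq_zero r s hs.symm, smul_zero]
  · simp

theorem idempotent_mul_pow (h : IsSpectralDecomp A θ E) (r : Fin m) (k : ℕ) :
    E r * A ^ k = θ r ^ k • E r := by
  induction k with
  | zero => simp
  | succ k ih =>
    rw [pow_succ, ← mul_assoc, ih, smul_mul_assoc, h.idempotent_mul, smul_smul, pow_succ]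

theorem pow_eq_sum (h : IsSpectralDecomp A θ E) (k : ℕ) : A ^ k = ∑ r, θ r ^ k • E r := by
  rw [← one_mul (A ^ k), ← h.sum_eq_one, Finset.sum_mul]
  exact Finset.sum_congr rfl fun r _ => h.idempotent_mul_pow r k

theorem aeval_eq_sum (h : IsSpectralDecomp A θ E) (p : ℝ[X]) :
    aeval A p = ∑ r, p.eval (θ r) • E r := by
  simp only [aeval_eq_sum_range, h.pow_eq_sum, Finset.smul_sum, eval_eq_sum_range, Finset.sum_smul,
    smul_smul]
  exact Finset.sum_comm

theorem map_idempotent_mul_charmatrix (h : IsSpectralDecomp A θ E) (r : Fin m) :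
    (E r).map C * A.charmatrix = (X - C (θ r)) • (E r).map C := by
  have hmul : (E r).map (C : ℝ →+* ℝ[X]) * A.map C = C (θ r) • (E r).map C := by
    rw [← Matrix.map_mul, h.idempotent_mul]
    ext1 i j
    simp
  rw [charmatrix, RingHom.mapMatrix_apply, mul_sub, hmul, sub_smul, scalar_apply,
    ← smul_one_eq_diagonal, mul_smul_comm, mul_one]

/-- Every spectral idempotent is a polynomial in the matrix. -/
theorem aeval_basis (h : IsSpectralDecomp A θ E) (r : Fin m) :
    aeval A (Lagrange.basis Finset.univ θ r) = E r := by
  rw [h.aeval_eq_sum, Finset.sum_eq_single r]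
  · rw [Lagrange.eval_basis_self h.theta_inj.injOn (Finset.mem_univ r), one_smul]
  · intro s _ hs
    rw [Lagrange.eval_basis_of_ne hs.symm (Finset.mem_univ s), zero_smul]
  · simp

/-- The partial fraction expansion of the resolvent, with denominators cleared. -/
theorem prod_smul_adjugate_charmatrix (h : IsSpectralDecomp A θ E) :
    (∏ s, (X - C (θ s))) • A.charmatrix.adjugate =
      A.charpoly • ∑ r, (∏ s ∈ Finset.univ.erase r, (X - C (θ s))) • (E r).map C := by
  have hone : ∑ r, (E r).map (C : ℝ →+* ℝ[X]) = 1 := by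
    have := congrArg (C : ℝ →+* ℝ[X]).mapMatrix h.sum_eq_one
    simpa only [map_sum, map_one, RingHom.mapMatrix_apply] using this
  have hr (r : Fin m) : (X - C (θ r)) • ((E r).map C * A.charmatrix.adjugate) =
      A.charpoly • (E r).map C := by
    rw [← smul_mul_assoc, ← h.map_idempotent_mul_charmatrix, mul_assoc, mul_adjugate,
      mul_smul_comm, mul_one, charpoly]
  rw [← one_mul A.charmatrix.adjugate, ← hone, Finset.sum_mul, Finset.smul_sum, Finset.smul_sum]
  refine Finset.sum_congr rfl fun r _ => ?_
  rw [← Finset.prod_erase_mul _ _ (Finset.mem_univ r), mul_smul, hr, smul_comm]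

theorem adjugate_charmatrix_apply_self_eq_iff (h : IsSpectralDecomp A θ E) (a b : V) :
    A.charmatrix.adjugate a a = A.charmatrix.adjugate b b ↔ ∀ r, E r a a = E r b b := by
  have key (u : V) : (∏ s, (X - C (θ s))) * A.charmatrix.adjugate u u =
      A.charpoly * ∑ r, (∏ s ∈ Finset.univ.erase r, (X - C (θ s))) * C (E r u u) := by
    simpa [Matrix.sum_apply] using congrFun (congrFun h.prod_smul_adjugate_charmatrix u) u
  constructor
  · intro hab r
    have heq := (key a).symm.trans ((congrArg _ hab).trans (key b))
    have hev := congrArg (eval (θ r)) (mul_left_cancel₀ A.charpoly_monic.ne_zero heq)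
    have hsum (u : V) :
        eval (θ r) (∑ t, (∏ s ∈ Finset.univ.erase t, (X - C (θ s))) * C (E t u u)) =
          (∏ s ∈ Finset.univ.erase r, (θ r - θ s)) * E r u u := by
      rw [eval_finsetSum, Finset.sum_eq_single r]
      · simp [eval_prod]
      · intro t _ ht
        rw [eval_mul, eval_prod, Finset.prod_eq_zero (i := r) (by simpa using ht.symm) (by simp),
          zero_mul]
      · simp
    rw [hsum, hsum] at hev
    refine mul_left_cancel₀ (Finset.prod_ne_zero_iff.mpr fun s hs => ?_) hev
    exact sub_ne_zero.mpr fun hθ => Finset.ne_of_mem_erase hs (h.theta_inj hθ).symm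
  · intro hE
    have hne : ∏ s, (X - C (θ s)) ≠ 0 :=
      Finset.prod_ne_zero_iff.mpr fun s _ => X_sub_C_ne_zero (θ s)
    refine mul_left_cancel₀ hne ?_
    rw [key, key]
    simp only [hE]

theorem idempotent_apply_self_eq_iff (h : IsSpectralDecomp A θ E) (a b : V) :
    (∀ r, E r a a = E r b b) ↔ ∀ k : ℕ, (A ^ k) a a = (A ^ k) b b := by
  constructor
  · intro hE k
    simp [h.pow_eq_sum, Matrix.sum_apply, hE]
  · intro hA r
    rw [← h.aeval_basis r]
    simp [aeval_eq_sum_range, Matrix.sum_apply, hA]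

end IsSpectralDecomp

/-- Characterizations of cospectral vertices. -/
theorem cospectral_tfae {V : Type*} [Fintype V] [DecidableEq V] (X : SimpleGraph V)
    [DecidableRel X.Adj] {m : ℕ} (θ : Fin m → ℝ) (E : Fin m → Matrix V V ℝ)
    (hdec : IsSpectralDecomp (X.adjMatrix ℝ) θ E) (a b : V) :
    List.TFAE
      [ ((X.adjMatrix ℝ).submatrix (fun i : {x : V // x ≠ a} => (i : V))
            (fun i : {x : V // x ≠ a} => (i : V))).charpoly =
          ((X.adjMatrix ℝ).submatrix (fun i : {x : V // x ≠ b} => (i : V))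
            (fun i : {x : V // x ≠ b} => (i : V))).charpoly,
        ∀ r, E r a a = E r b b,
        ∀ k : ℕ, (X.adjMatrix ℝ ^ k) a a = (X.adjMatrix ℝ ^ k) b b,
        (Matrix.of fun i (j : Fin (Fintype.card V)) => (X.adjMatrix ℝ ^ (j : ℕ)) i a)ᵀ *
            (Matrix.of fun i (j : Fin (Fintype.card V)) => (X.adjMatrix ℝ ^ (j : ℕ)) i a) =
          (Matrix.of fun i (j : Fin (Fintype.card V)) => (X.adjMatrix ℝ ^ (j : ℕ)) i b)ᵀ *
            (Matrix.of fun i (j : Fin (Fintype.card V)) => (X.adjMatrix ℝ ^ (j : ℕ)) i b),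
        ∀ k : ℕ,
          (Pi.single a (1 : ℝ) - Pi.single b 1) ⬝ᵥ
            ((X.adjMatrix ℝ ^ k) *ᵥ (Pi.single a 1 + Pi.single b 1)) = 0 ] := by
  have hA : (X.adjMatrix ℝ).IsSymm := X.isSymm_adjMatrix
  tfae_have 1 ↔ 2 := by
    rw [charpoly_submatrix_ne_eq_adjugate, charpoly_submatrix_ne_eq_adjugate]
    exact hdec.adjugate_charmatrix_apply_self_eq_iff a b
  tfae_have 2 ↔ 3 := hdec.idempotent_apply_self_eq_iff a b
  tfae_have 3 → 4 := by
    intro h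
    ext i j
    rw [hA.walk_gram_apply, hA.walk_gram_apply, h]
  tfae_have 4 → 3 := by
    intro h
    refine forall_pow_apply_self_eq_of_lt_card fun k hk => ?_
    have hkz := congrFun (congrFun h ⟨k, hk⟩) ⟨0, k.zero_le.trans_lt hk⟩
    rwa [hA.walk_gram_apply, hA.walk_gram_apply] at hkz
  tfae_have 3 ↔ 5 := by
    refine forall_congr' fun k => ?_
    rw [(hA.pow k).sub_dotProduct_mulVec_add, sub_eq_zero]
  tfae_finish
end

section
/- All eigenvalues of the adjacency matrix A of a finite simple graph X are simple (every eigenspace of A has dimension one) if and only if every pair of vertices of X is parallel. -/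
open Matrix BigOperators

/-- A nonzero matrix has rank one iff any two of its columns are parallel. -/
theorem Matrix.rank_eq_one_iff_cols_parallel {K m n : Type*} [Field K] [Fintype m] [Fintype n]
    {M : Matrix m n K} (hM : M ≠ 0) :
    M.rank = 1 ↔ ∀ a b, (∃ c : K, M.col a = c • M.col b) ∨ (∃ c : K, M.col b = c • M.col a) := by
  rw [Matrix.rank_eq_finrank_span_cols]
  constructor
  · intro h a b
    obtain ⟨v, hv⟩ := finrank_le_one_iff.mp h.le
    obtain ⟨x, hx⟩ := hv ⟨M.col a, Submodule.subset_span ⟨a, rfl⟩⟩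
    obtain ⟨y, hy⟩ := hv ⟨M.col b, Submodule.subset_span ⟨b, rfl⟩⟩
    replace hx : x • (v : m → K) = M.col a := congrArg Subtype.val hx
    replace hy : y • (v : m → K) = M.col b := congrArg Subtype.val hy
    rcases eq_or_ne y 0 with rfl | hy0
    · exact Or.inr ⟨0, by simp [← hy]⟩
    · exact Or.inl ⟨x / y, by rw [← hx, ← hy, smul_smul, div_mul_cancel₀ _ hy0]⟩
  · intro h
    obtain ⟨b, hb⟩ : ∃ b, M.col b ≠ 0 := by
      by_contra! hcol
      exact hM (Matrix.ext fun i j => congrFun (hcol j) i)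
    have hspan : Submodule.span K (Set.range M.col) = K ∙ M.col b := by
      refine le_antisymm (Submodule.span_le.mpr ?_)
        (Submodule.span_mono (Set.singleton_subset_iff.mpr ⟨b, rfl⟩))
      rintro _ ⟨a, rfl⟩
      refine Submodule.mem_span_singleton.mpr ?_
      rcases h a b with ⟨c, hc⟩ | ⟨c, hc⟩
      · exact ⟨c, hc.symm⟩
      · have hc0 : c ≠ 0 := by
          rintro rfl
          exact hb (by simpa using hc)
        exact ⟨c⁻¹, by rw [hc, inv_smul_smul₀ hc0]⟩
    rw [hspan, finrank_span_singleton hb]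

/-- All eigenvalues of `X` are simple if and only if every two vertices are parallel. -/
theorem simple_eigenvalues_iff_all_parallel {V : Type*} [Fintype V] [DecidableEq V]
    (X : SimpleGraph V) [DecidableRel X.Adj] {m : ℕ} (θ : Fin m → ℝ)
    (E : Fin m → Matrix V V ℝ) (hdec : IsSpectralDecomp (X.adjMatrix ℝ) θ E) :
    (∀ r, (E r).rank = 1) ↔
      ∀ a b : V, ∀ r,
        (∃ c : ℝ, E r *ᵥ Pi.single a 1 = c • (E r *ᵥ Pi.single b 1)) ∨
        (∃ c : ℝ, E r *ᵥ Pi.single b 1 = c • (E r *ᵥ Pi.single a 1)) := by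
  simp only [Matrix.mulVec_single_one]
  rw [forall_congr' fun r => Matrix.rank_eq_one_iff_cols_parallel (hdec.ne_zero r)]
  exact ⟨fun h a b r => h r a b, fun h r a b => h a b r⟩
end

section
/- Vertices a and b of a finite simple graph X are strongly cospectral if and only if Φ(D_a) = Φ(D_b), where D_u = e_u e_u^T and Φ(M) = Σ_r E_r M E_r is the sum over the spectral idempotents of the adjacency matrix A. -/
open Matrix BigOperators

/-- Real vectors have the same rank-one matrix `u uᵀ` exactly when they agree up to sign. -/
theorem vecMulVec_self_eq_vecMulVec_self_iff {V : Type*} (u w : V → ℝ) :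
    Matrix.vecMulVec u u = Matrix.vecMulVec w w ↔ u = w ∨ u = -w := by
  constructor
  · intro h
    have h' : ∀ i j, u i * u j = w i * w j := fun i j => by
      simpa [Matrix.vecMulVec_apply] using congrFun (congrFun h i) j
    by_cases hw : w = 0
    · left
      ext i
      simpa [hw] using h' i i
    · obtain ⟨i, hi⟩ := Function.ne_iff.mp hw
      rcases mul_self_eq_mul_self_iff.mp (h' i i) with hs | hs
      · left
        ext j
        have hij := h' i j
        rw [hs] at hij
        exact mul_left_cancel₀ hi hij
      · right
        ext j
        have hij := h' i j
        rw [hs] at hij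
        exact mul_left_cancel₀ hi (by simp only [Pi.neg_apply]; linarith)
  · rintro (rfl | rfl)
    · rfl
    · simp [Matrix.neg_vecMulVec, Matrix.vecMulVec_neg]

/-- Compressing `v vᵀ` by a symmetric matrix `P` gives the rank-one matrix of `P v`. -/
theorem mul_vecMulVec_self_mul_of_symm {V : Type*} [Fintype V] {P : Matrix V V ℝ}
    (hP : Pᵀ = P) (v : V → ℝ) :
    P * Matrix.vecMulVec v v * P = Matrix.vecMulVec (P *ᵥ v) (P *ᵥ v) := by
  rw [Matrix.mul_vecMulVec, Matrix.vecMulVec_mul, ← Matrix.mulVec_transpose, hP]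

/-- Orthogonal idempotents recover each block of a pinched matrix. -/
theorem mul_sum_mul_mul_of_orthogonal {V ι : Type*} [Fintype V] [Fintype ι]
    {E : ι → Matrix V V ℝ} (hidem : ∀ r, E r * E r = E r)
    (horth : ∀ r s, r ≠ s → E r * E s = 0) (M : Matrix V V ℝ) (r : ι) :
    E r * ∑ s, E s * M * E s = E r * M * E r := by
  rw [Finset.mul_sum, Finset.sum_eq_single r]
  · simp only [← Matrix.mul_assoc, hidem]
  · intro s _ hs
    simp only [← Matrix.mul_assoc, horth r s hs.symm, Matrix.zero_mul]
  · simp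

/-- Vertices `a` and `b` are strongly cospectral iff the average states
`Φ(D_a)` and `Φ(D_b)` are equal, where `Φ(M) = ∑ r, E r * M * E r`. -/
theorem stronglyCospectral_iff_averageState_eq {V : Type*} [Fintype V] [DecidableEq V]
    (X : SimpleGraph V) [DecidableRel X.Adj] {m : ℕ} (θ : Fin m → ℝ)
    (E : Fin m → Matrix V V ℝ) (hdec : IsSpectralDecomp (X.adjMatrix ℝ) θ E) (a b : V) :
    (∀ r, E r *ᵥ Pi.single a 1 = E r *ᵥ Pi.single b 1 ∨
        E r *ᵥ Pi.single a 1 = -(E r *ᵥ Pi.single b 1)) ↔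
      ∑ r, E r * Matrix.vecMulVec (Pi.single a 1) (Pi.single a 1) * E r =
        ∑ r, E r * Matrix.vecMulVec (Pi.single b 1) (Pi.single b 1) * E r := by
  have hblock : ∀ r, (E r *ᵥ Pi.single a 1 = E r *ᵥ Pi.single b 1 ∨
        E r *ᵥ Pi.single a 1 = -(E r *ᵥ Pi.single b 1)) ↔
      E r * Matrix.vecMulVec (Pi.single a 1) (Pi.single a 1) * E r =
        E r * Matrix.vecMulVec (Pi.single b 1) (Pi.single b 1) * E r := fun r => by
    rw [mul_vecMulVec_self_mul_of_symm (hdec.symm r), mul_vecMulVec_self_mul_of_symm (hdec.symm r),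
      vecMulVec_self_eq_vecMulVec_self_iff]
  simp only [hblock]
  constructor
  · intro h
    exact Finset.sum_congr rfl fun r _ => h r
  · intro h r
    rw [← mul_sum_mul_mul_of_orthogonal hdec.idem hdec.mul_eq_zero, h,
      mul_sum_mul_mul_of_orthogonal hdec.idem hdec.mul_eq_zero]
end

section
/- Distinct vertices a and b of a finite simple graph X with adjacency matrix A are strongly cospectral if and only if (1) a and b are cospectral, and (2) for every real number θ, the multiplicity of θ as a root of the characteristic polynomial of A exceeds the multiplicity of θ as a root of the characteristic polynomial of the principal submatrix of A obtained by deleting the rows and columns indexed by a and b by at most one (i.e., all poles of φ(X∖{a,b},t)/φ(X,t) are simple). -/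
open Matrix BigOperators

open Polynomial

/-- Jacobi's identity for complementary minors, up to a factor `det M`: a principal minor of the
adjugate in terms of the complementary principal minor of the matrix. -/
theorem det_mul_det_adjugate_toSquareBlockProp {V R : Type*} [Fintype V] [DecidableEq V]
    [CommRing R] (M : Matrix V V R) (q : V → Prop) [DecidablePred q] :
    M.det * (M.adjugate.toSquareBlockProp (fun x => ¬ q x)).det =
      M.det ^ Fintype.card {x // ¬ q x} * (M.toSquareBlockProp q).det := by
  let N : Matrix V V R :=
    Matrix.of fun i j => if q j then (1 : Matrix V V R) i j else M.adjugate i j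
  have hMN : M * N =
      Matrix.of fun i j => if q j then M i j else (M.det • (1 : Matrix V V R)) i j := by
    ext i j
    by_cases hj : q j
    · have h : (M * N) i j = (M * (1 : Matrix V V R)) i j := by
        simp only [Matrix.mul_apply, N, Matrix.of_apply, hj, if_true]
      rw [h]; simp [hj]
    · have h : (M * N) i j = (M * M.adjugate) i j := by
        simp only [Matrix.mul_apply, N, Matrix.of_apply, hj, if_false]
      rw [h, Matrix.mul_adjugate]; simp [hj]
  have hN : N.det = (M.adjugate.toSquareBlockProp (fun x => ¬ q x)).det := by
    rw [Matrix.twoBlockTriangular_det N q]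
    · have h1 : N.toSquareBlockProp q = 1 := by
        ext i j
        simp [N, Matrix.toSquareBlockProp, j.2, Matrix.one_apply, Subtype.ext_iff]
      have h2 : N.toSquareBlockProp (fun x => ¬ q x) =
          M.adjugate.toSquareBlockProp (fun x => ¬ q x) := by
        ext i j
        simp [N, Matrix.toSquareBlockProp, j.2]
      rw [h1, h2, Matrix.det_one, one_mul]
    · intro i hi j hj
      have : i ≠ j := fun h => hi (h ▸ hj)
      simp [N, hj, this]
  have hdet : (M * N).det =
      (M.toSquareBlockProp q).det * M.det ^ Fintype.card {x // ¬ q x} := by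
    rw [Matrix.twoBlockTriangular_det' (M * N) q]
    · have h1 : (M * N).toSquareBlockProp q = M.toSquareBlockProp q := by
        ext i j
        simp [hMN, Matrix.toSquareBlockProp, j.2]
      have h2 : (M * N).toSquareBlockProp (fun x => ¬ q x) = M.det • 1 := by
        ext i j
        simp [hMN, Matrix.toSquareBlockProp, j.2, Matrix.one_apply, Subtype.ext_iff]
      rw [h1, h2, Matrix.det_smul, Matrix.det_one, mul_one]
    · intro i hi j hj
      have : i ≠ j := fun h => hj (h ▸ hi)
      simp [hMN, hj, this]
  rw [← hN, ← Matrix.det_mul, hdet, mul_comm]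

theorem charpoly_submatrix_subtype_val {V R : Type*} [Fintype V] [DecidableEq V] [CommRing R]
    (A : Matrix V V R) (q : V → Prop) [DecidablePred q] :
    (A.submatrix (fun i : {x // q x} => (i : V)) (fun i : {x // q x} => (i : V))).charpoly =
      (A.charmatrix.toSquareBlockProp q).det := by
  rw [Matrix.charpoly]
  congr 1
  ext i j : 2
  simp [Matrix.toSquareBlockProp, Matrix.charmatrix_apply, Matrix.diagonal_apply, Subtype.ext_iff]

theorem charpoly_delete_vertex {V R : Type*} [Fintype V] [DecidableEq V] [CommRing R]
    (A : Matrix V V R) (a : V) :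
    (A.submatrix (fun i : {x // x ≠ a} => (i : V)) (fun i : {x // x ≠ a} => (i : V))).charpoly =
      A.charmatrix.adjugate a a := by
  have h := det_mul_det_adjugate_toSquareBlockProp A.charmatrix (fun x => x ≠ a)
  let u : Unique {x // ¬ x ≠ a} := ⟨⟨⟨a, by simp⟩⟩, fun x => Subtype.ext (not_not.mp x.2)⟩
  have hdet := Matrix.det_unique (A.charmatrix.adjugate.toSquareBlockProp fun x => ¬ x ≠ a)
  have hcard : Fintype.card {x // ¬ x ≠ a} = 1 := Fintype.card_unique
  rw [← charpoly_submatrix_subtype_val, hdet, hcard, pow_one] at h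
  exact ((Matrix.charpoly_monic A).isRegular.left h).symm

theorem charpoly_mul_charpoly_delete_pair {V R : Type*} [Fintype V] [DecidableEq V] [CommRing R]
    (A : Matrix V V R) {a b : V} (hab : a ≠ b) :
    A.charpoly * (A.submatrix (fun i : {x // x ≠ a ∧ x ≠ b} => (i : V))
        (fun i : {x // x ≠ a ∧ x ≠ b} => (i : V))).charpoly =
      A.charmatrix.adjugate a a * A.charmatrix.adjugate b b -
        A.charmatrix.adjugate a b * A.charmatrix.adjugate b a := by
  have h := det_mul_det_adjugate_toSquareBlockProp A.charmatrix (fun x => x ≠ a ∧ x ≠ b)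
  let f : Fin 2 → {x // ¬ (x ≠ a ∧ x ≠ b)} := ![⟨a, by simp⟩, ⟨b, by simp⟩]
  have hf : Function.Bijective f := by
    constructor
    · intro i j hij
      fin_cases i <;> fin_cases j <;> simp_all [f]
    · rintro ⟨x, hx⟩
      by_cases hxa : x = a
      · exact ⟨0, Subtype.ext hxa.symm⟩
      · exact ⟨1, Subtype.ext (not_not.mp fun hxb => hx ⟨hxa, Ne.symm hxb⟩)⟩
  let e : Fin 2 ≃ {x // ¬ (x ≠ a ∧ x ≠ b)} := Equiv.ofBijective f hf
  rw [← charpoly_submatrix_subtype_val, ← Matrix.det_submatrix_equiv_self e, Matrix.det_fin_two,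
    ← Fintype.card_congr e, Fintype.card_fin, pow_two, mul_assoc] at h
  exact ((Matrix.charpoly_monic A).isRegular.left h).symm

section SpectralDecomp

variable {V : Type*} [Fintype V] [DecidableEq V] {A : Matrix V V ℝ} {m : ℕ} {θ : Fin m → ℝ}
  {E : Fin m → Matrix V V ℝ}

/-- The numerator of `∑ r, c r / (X - θ r)` over the common denominator `∏ r, (X - θ r)`. -/
noncomputable def poleNumerator (θ : Fin m → ℝ) (c : Fin m → ℝ) : ℝ[X] :=
  ∑ r, (∏ s ∈ Finset.univ.erase r, (X - C (θ s))) * C (c r)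

theorem eval_prod_erase_ne_zero (hθ : Function.Injective θ) (r : Fin m) :
    (∏ s ∈ Finset.univ.erase r, (X - C (θ s))).eval (θ r) ≠ 0 := by
  rw [eval_prod, Finset.prod_ne_zero_iff]
  intro s hs
  rw [eval_sub, eval_X, eval_C, sub_ne_zero]
  exact fun h => Finset.ne_of_mem_erase hs (hθ h).symm

theorem eval_poleNumerator (c : Fin m → ℝ) (r : Fin m) :
    (poleNumerator θ c).eval (θ r) =
      (∏ s ∈ Finset.univ.erase r, (X - C (θ s))).eval (θ r) * c r := by
  rw [poleNumerator, eval_finsetSum, Finset.sum_eq_single r]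
  · simp
  · intro s _ hs
    rw [eval_mul, eval_prod, Finset.prod_eq_zero (i := r) (by simp [hs.symm]) (by simp), zero_mul]
  · simp

theorem poleNumerator_injective (hθ : Function.Injective θ) :
    Function.Injective (poleNumerator θ) := by
  intro c d h
  ext r
  have h' := congrArg (Polynomial.eval (θ r)) h
  rw [eval_poleNumerator, eval_poleNumerator] at h'
  exact mul_left_cancel₀ (eval_prod_erase_ne_zero hθ r) h'

theorem prod_X_sub_C_mul_adjugate_charmatrix (h : IsSpectralDecomp A θ E) (i j : V) :
    (∏ r, (X - C (θ r))) * A.charmatrix.adjugate i j =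
      A.charpoly * poleNumerator θ (fun r => E r i j) := by
  let F : Fin m → Matrix V V ℝ[X] := fun r => (E r).map C
  have hF : ∀ r s, F r * F s = if r = s then F r else 0 := by
    intro r s
    have : F r * F s = (E r * E s).map C := (Matrix.map_mul).symm
    rw [this]
    split_ifs with hrs
    · rw [← hrs, h.idem]
    · rw [h.mul_eq_zero r s hrs]; simp
  have hsum : ∑ r, F r = 1 := by
    have := congrArg (C : ℝ →+* ℝ[X]).mapMatrix h.sum_eq_one
    rwa [map_sum, map_one] at this
  have hM : A.charmatrix = ∑ r, (X - C (θ r)) • F r := by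
    have hA : (C : ℝ →+* ℝ[X]).mapMatrix A = ∑ r, C (θ r) • F r := by
      rw [h.eq_sum, map_sum]
      refine Finset.sum_congr rfl fun r _ => ?_
      ext i j : 2
      simp [F]
    rw [Matrix.charmatrix, hA]
    simp only [sub_smul, Finset.sum_sub_distrib, ← Finset.smul_sum, hsum]
    congr 1
    ext i j : 2
    simp [Matrix.one_apply, Matrix.diagonal_apply]
  let Q : Matrix V V ℝ[X] := ∑ r, (∏ s ∈ Finset.univ.erase r, (X - C (θ s))) • F r
  have hMQ : A.charmatrix * Q = (∏ r, (X - C (θ r))) • (1 : Matrix V V ℝ[X]) := by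
    rw [hM, Finset.sum_mul, ← hsum, Finset.smul_sum]
    refine Finset.sum_congr rfl fun r _ => ?_
    rw [Finset.mul_sum, Finset.sum_eq_single r]
    · rw [Matrix.smul_mul, Matrix.mul_smul, hF, if_pos rfl, smul_smul,
        Finset.mul_prod_erase _ (fun s => X - C (θ s)) (Finset.mem_univ r)]
    · intro s _ hs
      rw [Matrix.smul_mul, Matrix.mul_smul, hF, if_neg hs.symm, smul_zero, smul_zero]
    · simp
  have hQ : Q i j = poleNumerator θ (fun r => E r i j) := by
    simp [Q, F, poleNumerator, Matrix.sum_apply]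
  have key : (∏ r, (X - C (θ r))) • A.charmatrix.adjugate = A.charpoly • Q := by
    calc _ = A.charmatrix.adjugate * (A.charmatrix * Q) := by
          rw [hMQ, Matrix.mul_smul, mul_one]
      _ = _ := by
          rw [← mul_assoc, Matrix.adjugate_mul, Matrix.smul_mul, one_mul, Matrix.charpoly]
  rw [← hQ]
  exact congrFun (congrFun key i) j

theorem prod_X_sub_C_ne_zero (θ : Fin m → ℝ) : (∏ r, (X - C (θ r))) ≠ 0 :=
  (monic_prod_of_monic _ _ fun r _ => monic_X_sub_C (θ r)).ne_zero

theorem cospectral_iff_diag_eq (h : IsSpectralDecomp A θ E) (a b : V) :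
    A.charmatrix.adjugate a a = A.charmatrix.adjugate b b ↔ ∀ r, E r a a = E r b b := by
  rw [← mul_right_inj' (prod_X_sub_C_ne_zero θ), prod_X_sub_C_mul_adjugate_charmatrix h,
    prod_X_sub_C_mul_adjugate_charmatrix h, mul_right_inj' A.charpoly_monic.ne_zero,
    (poleNumerator_injective h.theta_inj).eq_iff, funext_iff]

theorem rootMultiplicity_prod_X_sub_C (hθ : Function.Injective θ) (r : Fin m) :
    (∏ s, (X - C (θ s))).rootMultiplicity (θ r) = 1 := by
  rw [← Finset.mul_prod_erase _ _ (Finset.mem_univ r), rootMultiplicity_mul,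
    rootMultiplicity_X_sub_C_self, rootMultiplicity_eq_zero (eval_prod_erase_ne_zero hθ r)]
  rw [Finset.mul_prod_erase _ (fun s => X - C (θ s)) (Finset.mem_univ r)]
  exact prod_X_sub_C_ne_zero θ

theorem simple_poles_iff (h : IsSpectralDecomp A θ E) {a b : V} (hab : a ≠ b) :
    (∀ t : ℝ, A.charpoly.rootMultiplicity t ≤
      (A.submatrix (fun i : {x // x ≠ a ∧ x ≠ b} => (i : V))
        (fun i : {x // x ≠ a ∧ x ≠ b} => (i : V))).charpoly.rootMultiplicity t + 1) ↔
      ∀ r, E r a a * E r b b = E r a b * E r b a := by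
  set φ := A.charpoly
  set ψ := (A.submatrix (fun i : {x // x ≠ a ∧ x ≠ b} => (i : V))
    (fun i : {x // x ≠ a ∧ x ≠ b} => (i : V))).charpoly
  set P : ℝ[X] := ∏ r, (X - C (θ r)) with hP
  let n : V → V → ℝ[X] := fun i j => poleNumerator θ (fun r => E r i j)
  let D : ℝ[X] := n a a * n b b - n a b * n b a
  have hφ0 : φ ≠ 0 := A.charpoly_monic.ne_zero
  have hψ0 : ψ ≠ 0 := (Matrix.charpoly_monic _).ne_zero
  have hP0 : P ≠ 0 := prod_X_sub_C_ne_zero θ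
  have hD : P * P * ψ = φ * D := by
    apply mul_left_cancel₀ hφ0
    have hadj : ∀ i j, P * A.charmatrix.adjugate i j = φ * n i j :=
      prod_X_sub_C_mul_adjugate_charmatrix h
    have hpair := charpoly_mul_charpoly_delete_pair A hab
    linear_combination P * P * hpair + P * A.charmatrix.adjugate b b * hadj a a
      + φ * n a a * hadj b b - P * A.charmatrix.adjugate b a * hadj a b - φ * n a b * hadj b a
  have hφD : φ * D ≠ 0 := hD ▸ mul_ne_zero (mul_ne_zero hP0 hP0) hψ0
  have hD0 : D ≠ 0 := right_ne_zero_of_mul hφD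
  have hmult : ∀ t, P.rootMultiplicity t + P.rootMultiplicity t + ψ.rootMultiplicity t =
      φ.rootMultiplicity t + D.rootMultiplicity t := by
    intro t
    rw [← rootMultiplicity_mul (mul_ne_zero hP0 hP0),
      ← rootMultiplicity_mul (mul_ne_zero (mul_ne_zero hP0 hP0) hψ0), hD,
      rootMultiplicity_mul hφD]
  have hroot : ∀ r, 0 < D.rootMultiplicity (θ r) ↔ E r a a * E r b b = E r a b * E r b a := by
    intro r
    have hc := eval_prod_erase_ne_zero h.theta_inj r
    rw [rootMultiplicity_pos hD0, IsRoot.def]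
    simp only [D, n, eval_sub, eval_mul, eval_poleNumerator]
    set c := (∏ s ∈ Finset.univ.erase r, (X - C (θ s))).eval (θ r)
    have : c * E r a a * (c * E r b b) - c * E r a b * (c * E r b a) =
        c ^ 2 * (E r a a * E r b b - E r a b * E r b a) := by ring
    rw [this, mul_eq_zero, sub_eq_zero, or_iff_right (pow_ne_zero 2 hc)]
  constructor
  · intro hpole r
    have h1 := rootMultiplicity_prod_X_sub_C h.theta_inj r
    have h2 := hmult (θ r)
    have h3 := hpole (θ r)
    rw [← hP] at h1
    exact (hroot r).1 (by omega)
  · intro hE t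
    have h2 := hmult t
    by_cases ht : ∃ r, θ r = t
    · obtain ⟨r, rfl⟩ := ht
      have h1 := rootMultiplicity_prod_X_sub_C h.theta_inj r
      have h3 := (hroot r).2 (hE r)
      rw [← hP] at h1
      omega
    · have h1 : P.rootMultiplicity t = 0 := by
        apply rootMultiplicity_eq_zero
        rw [IsRoot.def, hP, eval_prod, Finset.prod_eq_zero_iff]
        rintro ⟨r, -, hr⟩
        exact ht ⟨r, by simpa [sub_eq_zero, eq_comm] using hr⟩
      omega

end SpectralDecomp

/-- Two columns of an orthogonal projection agree up to sign iff the corresponding diagonal entries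
agree and the corresponding principal `2 × 2` minor vanishes. -/
theorem col_eq_or_eq_neg_iff {V : Type*} [Fintype V] [DecidableEq V] {F : Matrix V V ℝ}
    (hsymm : Fᵀ = F) (hidem : F * F = F) (a b : V) :
    (F *ᵥ Pi.single a 1 = F *ᵥ Pi.single b 1 ∨ F *ᵥ Pi.single a 1 = -(F *ᵥ Pi.single b 1)) ↔
      F a a = F b b ∧ F a a * F b b = F a b * F b a := by
  have hs : ∀ i j, F i j = F j i := fun i j => congrFun (congrFun hsymm j) i
  have hdot : ∀ i j, ∑ x, F x i * F x j = F i j := by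
    intro i j
    conv_rhs => rw [← hidem, Matrix.mul_apply]
    exact Finset.sum_congr rfl fun x _ => by rw [hs x i]
  simp only [Matrix.mulVec_single_one, funext_iff, Matrix.col_apply, Pi.neg_apply]
  constructor
  · rintro (h | h)
    · have h1 := h a
      have h2 := h b
      have h3 := hs a b
      exact ⟨by linarith, by rw [h1, h2]⟩
    · have h1 := h a
      have h2 := h b
      have h3 := hs a b
      exact ⟨by linarith, by rw [h1, h2]; ring⟩
  · rintro ⟨h1, h2⟩
    have hsq : (F a a - F a b) * (F a a + F a b) = 0 := by
      rw [← h1, ← hs a b] at h2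
      linear_combination h2
    have hexp : ∀ c : ℝ, c ^ 2 = 1 → F a a = c * F a b → ∀ x, F x a - c * F x b = 0 := by
      intro c hc hac
      have hsum : ∑ x, (F x a - c * F x b) ^ 2 = 0 := by
        calc _ = ∑ x, F x a * F x a - 2 * c * ∑ x, F x a * F x b
              + c ^ 2 * ∑ x, F x b * F x b := by
              simp only [Finset.mul_sum, ← Finset.sum_sub_distrib, ← Finset.sum_add_distrib]
              exact Finset.sum_congr rfl fun x _ => by ring
          _ = 0 := by
              rw [hdot, hdot, hdot, hc, ← h1]
              linear_combination 2 * hac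
      intro x
      exact pow_eq_zero_iff two_ne_zero |>.1
        ((Finset.sum_eq_zero_iff_of_nonneg fun y _ => sq_nonneg _).1 hsum x (Finset.mem_univ x))
    rcases mul_eq_zero.1 hsq with h | h
    · left
      intro x
      linarith [hexp 1 (by norm_num) (by linarith) x]
    · right
      intro x
      linarith [hexp (-1) (by norm_num) (by linarith) x]

/-- Distinct vertices `a` and `b` are strongly cospectral iff they are cospectral and all
poles of `φ(X∖{a,b},t)/φ(X,t)` are simple. -/
theorem stronglyCospectral_iff_cospectral_and_simple_poles {V : Type*} [Fintype V]
    [DecidableEq V] (X : SimpleGraph V) [DecidableRel X.Adj] {m : ℕ} (θ : Fin m → ℝ)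
    (E : Fin m → Matrix V V ℝ) (hdec : IsSpectralDecomp (X.adjMatrix ℝ) θ E)
    (a b : V) (hab : a ≠ b) :
    (∀ r, E r *ᵥ Pi.single a 1 = E r *ᵥ Pi.single b 1 ∨
        E r *ᵥ Pi.single a 1 = -(E r *ᵥ Pi.single b 1)) ↔
      (((X.adjMatrix ℝ).submatrix (fun i : {x : V // x ≠ a} => (i : V))
            (fun i : {x : V // x ≠ a} => (i : V))).charpoly =
          ((X.adjMatrix ℝ).submatrix (fun i : {x : V // x ≠ b} => (i : V))
            (fun i : {x : V // x ≠ b} => (i : V))).charpoly ∧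
        ∀ θ' : ℝ,
          (X.adjMatrix ℝ).charpoly.rootMultiplicity θ' ≤
            ((X.adjMatrix ℝ).submatrix (fun i : {x : V // x ≠ a ∧ x ≠ b} => (i : V))
              (fun i : {x : V // x ≠ a ∧ x ≠ b} => (i : V))).charpoly.rootMultiplicity θ'
              + 1) := by
  simp only [charpoly_delete_vertex]
  rw [cospectral_iff_diag_eq hdec, simple_poles_iff hdec hab, ← forall_and]
  exact forall_congr' fun r => col_eq_or_eq_neg_iff (hdec.symm r) (hdec.idem r) a b
end

section
/- Let X and Y be finite simple graphs with distinguished vertices u ∈ V(X) and v ∈ V(Y), let k ≥ 1, and let Z be the graph on the disjoint union V(X) ⊔ {w_1,…,w_{k−1}} ⊔ V(Y) whose edges are the edges of X, the edges of Y, and the edges of the path u, w_1, w_2, …, w_{k−1}, v (when k = 1 this is just the single edge uv). If u and v are cospectral vertices of Z, then u and v are strongly cospectral vertices of Z. -/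
open Matrix BigOperators

open Polynomial in
/-- The characteristic polynomial of the matrix obtained by deleting row and column `a` is the
`(a, a)` entry of the adjugate of the characteristic matrix. -/
lemma charpoly_submatrix_ne_eq_adjugate_charmatrix {V R : Type*} [Fintype V] [DecidableEq V]
    [CommRing R] (A : Matrix V V R) (a : V) :
    (A.submatrix (fun i : {w : V // w ≠ a} => (i : V))
      (fun i : {w : V // w ≠ a} => (i : V))).charpoly = (charmatrix A).adjugate a a := by
  rw [adjugate_apply, twoBlockTriangular_det _ (fun w => w ≠ a)]
  · have hunit : (((charmatrix A).updateRow a (Pi.single a 1)).toSquareBlockProp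
        (fun w => ¬ w ≠ a)) = 1 := by
      ext ⟨i, hi⟩ ⟨j, hj⟩
      obtain rfl : i = a := not_not.mp hi
      obtain rfl : j = i := not_not.mp hj
      simp [toSquareBlockProp]
    rw [hunit, det_one, mul_one, charpoly]
    congr 1
    ext ⟨i, hi⟩ ⟨j, hj⟩ : 2
    simp [toSquareBlockProp, charmatrix_apply, updateRow_ne hi, diagonal_apply]
  · intro i hi j hj
    obtain rfl : i = a := not_not.mp hi
    simp [Pi.single_eq_of_ne hj]

namespace IsSpectralDecomp

variable {V : Type*} [Fintype V] [DecidableEq V] {A : Matrix V V ℝ} {m : ℕ} {θ : Fin m → ℝ}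
  {E : Fin m → Matrix V V ℝ}

lemma mul_idempotent (h : IsSpectralDecomp A θ E) (r : Fin m) : A * E r = θ r • E r := by
  rw [h.eq_sum, Finset.sum_mul, Finset.sum_eq_single r]
  · rw [smul_mul_assoc, h.idem]
  · intro s _ hs
    rw [smul_mul_assoc, h.mul_eq_zero s r hs, smul_zero]
  · simp

open Polynomial in
lemma adjugate_charmatrix_mul (h : IsSpectralDecomp A θ E) (r : Fin m) :
    (X - C (θ r)) • ((charmatrix A).adjugate * (E r).map C) = A.charpoly • (E r).map C := by
  have hE : charmatrix A * (E r).map C = (X - C (θ r)) • (E r).map C := by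
    have hmap : A.map C * (E r).map C = C (θ r) • (E r).map C := by
      rw [← Matrix.map_mul, h.mul_idempotent r]
      ext i j : 2
      simp
    rw [charmatrix, sub_mul, sub_smul, RingHom.mapMatrix_apply, hmap]
    simp [← smul_one_eq_diagonal, scalar_apply]
  rw [← Matrix.mul_smul, ← hE, ← Matrix.mul_assoc, adjugate_mul, smul_mul_assoc, one_mul, charpoly]

open Polynomial in
/-- Cospectral vertices have equal diagonal entries in every spectral idempotent. -/
lemma diag_eq_of_cospectral (h : IsSpectralDecomp A θ E) {a b : V}
    (hab : (A.submatrix (fun i : {w : V // w ≠ a} => (i : V))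
        (fun i : {w : V // w ≠ a} => (i : V))).charpoly =
      (A.submatrix (fun i : {w : V // w ≠ b} => (i : V))
        (fun i : {w : V // w ≠ b} => (i : V))).charpoly) (r : Fin m) :
    E r a a = E r b b := by
  rw [charpoly_submatrix_ne_eq_adjugate_charmatrix,
    charpoly_submatrix_ne_eq_adjugate_charmatrix] at hab
  let P : Fin m → ℝ[X] := fun r => ∏ s ∈ Finset.univ.erase r, (X - C (θ s))
  have hone : ∑ r, (E r).map C = (1 : Matrix V V ℝ[X]) := by
    have hsum := congrArg (C : ℝ →+* ℝ[X]).mapMatrix h.sum_eq_one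
    simpa only [map_sum, map_one, RingHom.mapMatrix_apply] using hsum
  have hadj : (∏ s, (X - C (θ s))) • (charmatrix A).adjugate =
      A.charpoly • ∑ r, P r • (E r).map C := by
    calc (∏ s, (X - C (θ s))) • (charmatrix A).adjugate
        = ∑ r, (∏ s, (X - C (θ s))) • ((charmatrix A).adjugate * (E r).map C) := by
          rw [← Finset.smul_sum, ← Finset.mul_sum, hone, mul_one]
      _ = ∑ r, A.charpoly • (P r • (E r).map C) := by
          refine Finset.sum_congr rfl fun r _ => ?_
          rw [← Finset.prod_erase_mul _ _ (Finset.mem_univ r), mul_smul,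
            h.adjugate_charmatrix_mul, smul_comm]
      _ = _ := by rw [Finset.smul_sum]
  have hentry (c : V) : (∏ s, (X - C (θ s))) * (charmatrix A).adjugate c c =
      A.charpoly * ∑ r, P r * C (E r c c) := by
    simpa [Matrix.sum_apply] using congrFun (congrFun hadj c) c
  have hsum : ∑ r, P r * C (E r a a) = ∑ r, P r * C (E r b b) :=
    mul_left_cancel₀ A.charpoly_monic.ne_zero (by rw [← hentry, ← hentry, hab])
  have heval (c : V) : (∑ r, P r * C (E r c c)).eval (θ r) = (P r).eval (θ r) * E r c c := by
    rw [eval_finsetSum, Finset.sum_eq_single r]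
    · simp
    · intro s _ hs
      have hz : (P s).eval (θ r) = 0 := by
        rw [eval_prod]
        exact Finset.prod_eq_zero (Finset.mem_erase.mpr ⟨hs.symm, Finset.mem_univ r⟩) (by simp)
      simp [hz]
    · simp
  have hP : (P r).eval (θ r) ≠ 0 := by
    rw [eval_prod]
    refine Finset.prod_ne_zero_iff.mpr fun s hs => ?_
    simpa [sub_eq_zero] using fun hrs => (Finset.mem_erase.mp hs).1 (h.theta_inj hrs).symm
  exact mul_left_cancel₀ hP (by rw [← heval, ← heval, hsum])

end IsSpectralDecomp

/-- If a symmetric block matrix has a single nonzero entry, equal to `1` and in position `(u, p)`,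
in its upper right block, then any two eigenvectors for the same eigenvalue have proportional
restrictions to `{u, p}`. -/
lemma eigenvector_mul_comm_of_bridge {α β : Type*} [Fintype α] [Fintype β] [DecidableEq α]
    [DecidableEq β] {A : Matrix (α ⊕ β) (α ⊕ β) ℝ} (hA : Aᵀ = A) {u : α} {p : β}
    (hup : ∀ x w, A (Sum.inl x) (Sum.inr w) = if x = u ∧ w = p then 1 else 0) {t : ℝ}
    {y z : α ⊕ β → ℝ} (hy : A *ᵥ y = t • y) (hz : A *ᵥ z = t • z) :
    y (Sum.inl u) * z (Sum.inr p) = y (Sum.inr p) * z (Sum.inl u) := by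
  have hrow {f : α ⊕ β → ℝ} (hf : A *ᵥ f = t • f) (x : α) :
      ∑ x', A (Sum.inl x) (Sum.inl x') * f (Sum.inl x') +
        (if x = u then f (Sum.inr p) else 0) = t * f (Sum.inl x) := by
    have := congrFun hf (Sum.inl x)
    simpa [mulVec, dotProduct, hup, ite_and] using this
  have hform (f g : α ⊕ β → ℝ) (hg : A *ᵥ g = t • g) :
      ∑ x, ∑ x', f (Sum.inl x) * A (Sum.inl x) (Sum.inl x') * g (Sum.inl x') +
        f (Sum.inl u) * g (Sum.inr p) = t * ∑ x, f (Sum.inl x) * g (Sum.inl x) := by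
    have := Finset.sum_congr rfl fun x (_ : x ∈ Finset.univ) =>
      congrArg (f (Sum.inl x) * ·) (hrow hg x)
    simp only [mul_add, Finset.sum_add_distrib, mul_ite, mul_zero, Finset.sum_ite_eq',
      Finset.mem_univ, if_true, Finset.mul_sum] at this
    simpa only [Finset.mul_sum, mul_assoc, mul_left_comm t] using this
  have hyz := hform y z hz
  have hzy := hform z y hy
  have hcomm : ∑ x, ∑ x', y (Sum.inl x) * A (Sum.inl x) (Sum.inl x') * z (Sum.inl x') =
      ∑ x, ∑ x', z (Sum.inl x) * A (Sum.inl x) (Sum.inl x') * y (Sum.inl x') := by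
    rw [Finset.sum_comm]
    refine Finset.sum_congr rfl fun x _ => Finset.sum_congr rfl fun x' _ => ?_
    rw [← congrFun (congrFun hA (Sum.inl x')) (Sum.inl x), transpose_apply]
    ring
  have hdot : ∑ x, y (Sum.inl x) * z (Sum.inl x) = ∑ x, z (Sum.inl x) * y (Sum.inl x) :=
    Finset.sum_congr rfl fun x _ => mul_comm _ _
  rw [hcomm, hdot] at hyz
  linarith

/-- Two solutions of `f (i + 2) = t * f (i + 1) - f i` that are proportional at the first two
indices are proportional at the indices `0` and `k`. -/
lemma mul_comm_of_recurrence {t : ℝ} {f g : ℕ → ℝ} {k : ℕ}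
    (hf : ∀ i, i + 2 ≤ k → f i + f (i + 2) = t * f (i + 1))
    (hg : ∀ i, i + 2 ≤ k → g i + g (i + 2) = t * g (i + 1))
    (h : f 0 * g 1 = f 1 * g 0) : f 0 * g k = f k * g 0 := by
  suffices ∀ i ≤ k, f 0 * g i = f i * g 0 from this k le_rfl
  intro i
  induction i using Nat.twoStepInduction with
  | zero => exact fun _ => rfl
  | one => exact fun _ => h
  | more i ih ih' =>
    intro hi
    linear_combination f 0 * hg i hi - g 0 * hf i hi - ih (by omega) + t * ih' (by omega)

/-- The `i`-th vertex of the path joining `u` to `v`. -/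
def joinPathVertex {VX VY : Type*} (u : VX) (v : VY) (k : ℕ) :
    ℕ → VX ⊕ (Fin (k - 1) ⊕ VY)
  | 0 => Sum.inl u
  | i + 1 => Sum.inr (if h : i < k - 1 then Sum.inl ⟨i, h⟩ else Sum.inr v)

lemma IsSpectralDecomp.col_eq_or_eq_neg {V : Type*} [Fintype V] [DecidableEq V]
    {A : Matrix V V ℝ} {m : ℕ} {θ : Fin m → ℝ} {E : Fin m → Matrix V V ℝ}
    (h : IsSpectralDecomp A θ E) {r : Fin m} {a b : V} (hdiag : E r a a = E r b b)
    (hdet : E r a a * E r b b = E r b a * E r a b) :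
    E r *ᵥ Pi.single a 1 = E r *ᵥ Pi.single b 1 ∨
      E r *ᵥ Pi.single a 1 = -(E r *ᵥ Pi.single b 1) := by
  have hsymm (c d : V) : E r c d = E r d c := congrFun (congrFun (h.symm r) d) c
  have hdot (c d : V) : ∑ w, E r w c * E r w d = E r c d := by
    have := congrFun (congrFun (h.idem r) c) d
    rw [mul_apply] at this
    rw [← this]
    exact Finset.sum_congr rfl fun w _ => by rw [hsymm w c]
  have hsq (s : ℝ) : ∑ w, (E r w a - s * E r w b) ^ 2 =
      E r a a - 2 * s * E r a b + s ^ 2 * E r b b := by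
    rw [← hdot a a, ← hdot a b, ← hdot b b, Finset.mul_sum, Finset.mul_sum,
      ← Finset.sum_sub_distrib, ← Finset.sum_add_distrib]
    exact Finset.sum_congr rfl fun w _ => by ring
  have hcol (s : ℝ) (hs : E r a a - 2 * s * E r a b + s ^ 2 * E r b b = 0) (w : V) :
      E r w a = s * E r w b := by
    rw [← hsq, Finset.sum_eq_zero_iff_of_nonneg fun _ _ => sq_nonneg _] at hs
    exact sub_eq_zero.mp (pow_eq_zero_iff two_ne_zero |>.mp (hs w (Finset.mem_univ w)))
  rw [hsymm b a, ← hdiag] at hdet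
  simp only [mulVec_single_one]
  rcases mul_self_eq_mul_self_iff.mp hdet with hab | hab
  · left
    ext w
    simpa using hcol 1 (by rw [← hdiag, ← hab]; ring) w
  · right
    ext w
    simpa using hcol (-1) (by rw [← hdiag, hab]; ring) w

/-- If `Z` is obtained from disjoint graphs `X` and `Y` by joining `u ∈ V(X)` to
`v ∈ V(Y)` by a path of length `k ≥ 1` (with internal vertices `Fin (k-1)`),
and `u` and `v` are cospectral in `Z`, then they are strongly cospectral in `Z`. -/
theorem stronglyCospectral_of_cospectral_path_join {VX VY : Type*}
    [Fintype VX] [DecidableEq VX] [Fintype VY] [DecidableEq VY]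
    (X : SimpleGraph VX) (Y : SimpleGraph VY) (u : VX) (v : VY) (k : ℕ) (hk : 1 ≤ k)
    (Z : SimpleGraph (VX ⊕ (Fin (k - 1) ⊕ VY))) [DecidableRel Z.Adj]
    (hXX : ∀ x x' : VX, Z.Adj (Sum.inl x) (Sum.inl x') ↔ X.Adj x x')
    (hYY : ∀ y y' : VY, Z.Adj (Sum.inr (Sum.inr y)) (Sum.inr (Sum.inr y')) ↔ Y.Adj y y')
    (hXP : ∀ (x : VX) (i : Fin (k - 1)),
      Z.Adj (Sum.inl x) (Sum.inr (Sum.inl i)) ↔ x = u ∧ (i : ℕ) = 0)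
    (hXY : ∀ (x : VX) (y : VY),
      Z.Adj (Sum.inl x) (Sum.inr (Sum.inr y)) ↔ x = u ∧ y = v ∧ k = 1)
    (hPP : ∀ i j : Fin (k - 1),
      Z.Adj (Sum.inr (Sum.inl i)) (Sum.inr (Sum.inl j)) ↔
        ((i : ℕ) + 1 = (j : ℕ) ∨ (j : ℕ) + 1 = (i : ℕ)))
    (hPY : ∀ (i : Fin (k - 1)) (y : VY),
      Z.Adj (Sum.inr (Sum.inl i)) (Sum.inr (Sum.inr y)) ↔ (i : ℕ) = k - 2 ∧ y = v)
    (hcos : ((Z.adjMatrix ℝ).submatrix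
          (fun i : {w : VX ⊕ (Fin (k - 1) ⊕ VY) // w ≠ Sum.inl u} => (i : VX ⊕ (Fin (k - 1) ⊕ VY)))
          (fun i : {w : VX ⊕ (Fin (k - 1) ⊕ VY) // w ≠ Sum.inl u} =>
            (i : VX ⊕ (Fin (k - 1) ⊕ VY)))).charpoly =
        ((Z.adjMatrix ℝ).submatrix
          (fun i : {w : VX ⊕ (Fin (k - 1) ⊕ VY) // w ≠ Sum.inr (Sum.inr v)} =>
            (i : VX ⊕ (Fin (k - 1) ⊕ VY)))
          (fun i : {w : VX ⊕ (Fin (k - 1) ⊕ VY) // w ≠ Sum.inr (Sum.inr v)} =>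
            (i : VX ⊕ (Fin (k - 1) ⊕ VY)))).charpoly)
    {m : ℕ} (θ : Fin m → ℝ) (E : Fin m → Matrix (VX ⊕ (Fin (k - 1) ⊕ VY)) (VX ⊕ (Fin (k - 1) ⊕ VY)) ℝ)
    (hdec : IsSpectralDecomp (Z.adjMatrix ℝ) θ E) :
    ∀ r, E r *ᵥ Pi.single (Sum.inl u) 1 = E r *ᵥ Pi.single (Sum.inr (Sum.inr v)) 1 ∨
      E r *ᵥ Pi.single (Sum.inl u) 1 = -(E r *ᵥ Pi.single (Sum.inr (Sum.inr v)) 1) := by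
  intro r
  set g := joinPathVertex u v k with hg
  have hgk : g k = Sum.inr (Sum.inr v) := by
    obtain ⟨n, rfl⟩ := Nat.exists_eq_add_of_le' hk
    simp [hg, joinPathVertex]
  have heig (c : VX ⊕ (Fin (k - 1) ⊕ VY)) :
      Z.adjMatrix ℝ *ᵥ (E r).col c = θ r • (E r).col c := by
    ext w
    simpa [mul_apply, mulVec, dotProduct] using
      congrFun (congrFun (hdec.mul_idempotent r) w) c
  have hrec (z : VX ⊕ (Fin (k - 1) ⊕ VY) → ℝ) (hz : Z.adjMatrix ℝ *ᵥ z = θ r • z) (i : ℕ)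
      (hi : i + 2 ≤ k) : z (g i) + z (g (i + 2)) = θ r * z (g (i + 1)) := by
    have hnbr : Z.neighborFinset (g (i + 1)) = {g i, g (i + 2)} := by
      have hi' : i < k - 1 := by omega
      ext w
      rw [SimpleGraph.mem_neighborFinset, Finset.mem_insert, Finset.mem_singleton]
      rcases w with x | j | y
      · rw [Z.adj_comm]
        rcases i with _ | i <;> simp [hg, joinPathVertex, hi', hXP]
      · rcases i with _ | i <;> simp [hg, joinPathVertex, hi', hPP] <;> grind
      · rcases i with _ | i <;> simp [hg, joinPathVertex, hi', hPY] <;> grind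
    have hne : g i ≠ g (i + 2) := by
      rcases i with _ | i
      · simp [hg, joinPathVertex]
      · have hi' : i < k - 1 := by omega
        simp only [hg, joinPathVertex, hi', dif_pos]
        split_ifs <;> simp
    have hrow := congrFun hz (g (i + 1))
    rw [SimpleGraph.adjMatrix_mulVec_apply, hnbr, Finset.sum_pair hne] at hrow
    exact hrow
  have hbridge : (E r).col (g 0) (g 0) * (E r).col (g k) (g 1) =
      (E r).col (g 0) (g 1) * (E r).col (g k) (g 0) := by
    refine eigenvector_mul_comm_of_bridge Z.transpose_adjMatrix ?_ (heig _) (heig _)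
    rintro x (j | y)
    · rw [SimpleGraph.adjMatrix_apply]
      refine if_congr ?_ rfl rfl
      rw [hXP]
      grind
    · rw [SimpleGraph.adjMatrix_apply]
      refine if_congr ?_ rfl rfl
      rw [hXY]
      grind
  have hdet := mul_comm_of_recurrence (k := k) (f := fun i => (E r).col (g 0) (g i))
    (g := fun i => (E r).col (g k) (g i)) (hrec _ (heig _)) (hrec _ (heig _)) hbridge
  simp only [hgk] at hdet
  exact hdec.col_eq_or_eq_neg (hdec.diag_eq_of_cospectral hcos r) hdet
end

section
/- If a is a vertex of degree one in a finite simple graph X and b is its unique neighbour, then a and b are parallel. -/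
open Matrix BigOperators

/-- Each idempotent of a spectral decomposition of `A` absorbs `A` up to its eigenvalue. -/
theorem IsSpectralDecomp.mul_eq_smul {V : Type*} [Fintype V] [DecidableEq V]
    {A : Matrix V V ℝ} {m : ℕ} {θ : Fin m → ℝ} {E : Fin m → Matrix V V ℝ}
    (h : IsSpectralDecomp A θ E) (r : Fin m) : E r * A = θ r • E r := by
  rw [h.eq_sum, Finset.mul_sum, Finset.sum_eq_single r]
  · rw [Matrix.mul_smul, h.idem]
  · intro s _ hs
    rw [Matrix.mul_smul, h.mul_eq_zero r s hs.symm, smul_zero]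
  · simp

/-- The adjacency matrix maps the basis vector of a pendant vertex to that of its neighbour. -/
theorem adjMatrix_mulVec_single_of_unique_neighbor {V : Type*} [Fintype V] [DecidableEq V]
    (X : SimpleGraph V) [DecidableRel X.Adj] {a b : V} (hab : X.Adj a b)
    (huniq : ∀ c : V, X.Adj a c → c = b) :
    X.adjMatrix ℝ *ᵥ Pi.single a 1 = Pi.single b 1 := by
  ext c
  have hiff : X.Adj c a ↔ c = b := ⟨fun h => huniq c h.symm, fun h => h ▸ hab.symm⟩
  simp [Pi.single_apply, hiff]

/-- A vertex of degree one is parallel to its unique neighbour. -/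
theorem parallel_of_degree_one {V : Type*} [Fintype V] [DecidableEq V]
    (X : SimpleGraph V) [DecidableRel X.Adj] {m : ℕ} (θ : Fin m → ℝ)
    (E : Fin m → Matrix V V ℝ) (hdec : IsSpectralDecomp (X.adjMatrix ℝ) θ E)
    (a b : V) (hab : X.Adj a b) (huniq : ∀ c : V, X.Adj a c → c = b) :
    ∀ r,
      (∃ c : ℝ, E r *ᵥ Pi.single a 1 = c • (E r *ᵥ Pi.single b 1)) ∨
      (∃ c : ℝ, E r *ᵥ Pi.single b 1 = c • (E r *ᵥ Pi.single a 1)) := by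
  intro r
  refine Or.inr ⟨θ r, ?_⟩
  rw [← adjMatrix_mulVec_single_of_unique_neighbor X hab huniq, Matrix.mulVec_mulVec,
    hdec.mul_eq_smul, Matrix.smul_mulVec]
end

section
/- Vertices a and b of a finite simple graph X with adjacency matrix A are cospectral if and only if there exists a real orthogonal matrix Q that commutes with A and satisfies Q² = I and Q e_a = e_b. -/
open Matrix BigOperators

namespace Matrix

open Polynomial

variable {n R : Type*} [Fintype n] [DecidableEq n] [CommRing R]

/-- A diagonal entry of the adjugate is the corresponding principal minor. -/
theorem adjugate_apply_self (M : Matrix n n R) (a : n) :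
    M.adjugate a a = (M.submatrix (fun i : {x // x ≠ a} => (i : n))
      (fun i : {x // x ≠ a} => (i : n))).det := by
  have hsub : Subsingleton {i // ¬ i ≠ a} :=
    ⟨fun i j => Subtype.ext ((not_not.mp i.2).trans (not_not.mp j.2).symm)⟩
  have hblock : toSquareBlockProp (M.updateRow a (Pi.single a 1)) (fun i => i ≠ a) =
      M.submatrix (fun i : {x // x ≠ a} => (i : n)) (fun i : {x // x ≠ a} => (i : n)) := by
    ext i j
    simp [toSquareBlockProp_def, updateRow_ne i.2]
  rw [adjugate_apply, twoBlockTriangular_det _ (fun i => i ≠ a), hblock,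
    det_eq_elem_of_subsingleton (toSquareBlockProp _ fun i => ¬ i ≠ a) ⟨a, not_not.mpr rfl⟩]
  · simp [toSquareBlockProp_def]
  · intro i hi j hj
    obtain rfl := not_not.mp hi
    simp [hj]

theorem charpoly_submatrix_ne (A : Matrix n n R) (a : n) :
    (A.submatrix (fun i : {x // x ≠ a} => (i : n)) (fun i : {x // x ≠ a} => (i : n))).charpoly =
      A.charmatrix.adjugate a a := by
  rw [adjugate_apply_self, charpoly]
  congr 1
  ext1 i j
  simp [charmatrix_apply, diagonal_apply, Subtype.ext_iff]

theorem degree_map_C_mul_adjugate_charmatrix_lt [Nontrivial R] (A B : Matrix n n R) (i j : n) :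
    ((B.map C * A.charmatrix.adjugate) i j).degree < A.charpoly.degree := by
  have : Nonempty n := ⟨i⟩
  have hmul : (X - C A) * matPolyEquiv A.charmatrix.adjugate =
      A.charpoly.map (algebraMap R (Matrix n n R)) := by
    rw [← matPolyEquiv_charmatrix, ← map_mul, mul_adjugate, ← charpoly, matPolyEquiv_smul_one]
  have hdeg : (matPolyEquiv A.charmatrix.adjugate).natDegree + 1 ≤ Fintype.card n := by
    have hne : matPolyEquiv A.charmatrix.adjugate ≠ 0 := by
      intro h
      rw [h, mul_zero] at hmul
      exact ((A.charpoly_monic).map (algebraMap R (Matrix n n R))).ne_zero hmul.symm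
    have hnat := congrArg natDegree hmul
    rw [(monic_X_sub_C A).natDegree_mul' hne, natDegree_X_sub_C] at hnat
    have := natDegree_map_le (p := A.charpoly) (f := algebraMap R (Matrix n n R))
    rw [charpoly_natDegree_eq_dim] at this
    omega
  rw [charpoly_degree_eq_dim, degree_lt_iff_coeff_zero]
  intro k hk
  rw [← matPolyEquiv_coeff_apply, map_mul, matPolyEquiv_map_C, coeff_C_mul,
    coeff_eq_zero_of_natDegree_lt (by omega), mul_zero, zero_apply]

/-- If two diagonal entries of the adjugate of the characteristic matrix agree, then so do the
corresponding diagonal entries of all powers. -/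
theorem pow_apply_self_eq_of_adjugate_charmatrix [Nontrivial R] (A : Matrix n n R) {a b : n}
    (h : A.charmatrix.adjugate a a = A.charmatrix.adjugate b b) (k : ℕ) :
    (A ^ k) a a = (A ^ k) b b := by
  have hmap (k : ℕ) : (A ^ (k + 1)).map C * A.charmatrix.adjugate =
      (X : R[X]) • ((A ^ k).map C * A.charmatrix.adjugate) - A.charpoly • (A ^ k).map C := by
    have hA : A.map C = (X : R[X]) • (1 : Matrix n n R[X]) - A.charmatrix := by
      simp [charmatrix, smul_one_eq_diagonal, scalar_apply]
    rw [pow_succ, Matrix.map_mul, hA, mul_sub, sub_mul, mul_assoc _ A.charmatrix, mul_adjugate,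
      ← charpoly]
    simp
  have hrec (k : ℕ) (c : n) : ((A ^ (k + 1)).map C * A.charmatrix.adjugate) c c =
      X * ((A ^ k).map C * A.charmatrix.adjugate) c c - A.charpoly * C ((A ^ k) c c) := by
    rw [hmap]; simp
  have hstep (k : ℕ) (hk : ((A ^ k).map C * A.charmatrix.adjugate) a a =
      ((A ^ k).map C * A.charmatrix.adjugate) b b) : (A ^ k) a a = (A ^ k) b b := by
    have hdiff : A.charpoly * C ((A ^ k) b b - (A ^ k) a a) =
        ((A ^ (k + 1)).map C * A.charmatrix.adjugate) a a -
          ((A ^ (k + 1)).map C * A.charmatrix.adjugate) b b := by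
      rw [hrec, hrec, hk, C_sub]; ring
    have hlt : (A.charpoly * C ((A ^ k) b b - (A ^ k) a a)).degree < A.charpoly.degree := by
      rw [hdiff]
      exact (degree_sub_le _ _).trans_lt
        (max_lt (degree_map_C_mul_adjugate_charmatrix_lt A _ a a)
          (degree_map_C_mul_adjugate_charmatrix_lt A _ b b))
    by_contra hne
    exact A.charpoly_monic.not_dvd_of_degree_lt
      (fun h0 => hne (by
        rw [A.charpoly_monic.mul_right_eq_zero_iff, C_eq_zero, sub_eq_zero] at h0
        exact h0.symm)) hlt (dvd_mul_right _ _)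
  have hadj : ((A ^ k).map C * A.charmatrix.adjugate) a a =
      ((A ^ k).map C * A.charmatrix.adjugate) b b := by
    induction k with
    | zero => simpa using h
    | succ k ih => rw [hrec, hrec, ih, hstep k ih]
  exact hstep k hadj

theorem commute_map_C_adjugate_charmatrix [IsDomain R] {A Q : Matrix n n R} (h : Commute Q A) :
    Commute (Q.map C) A.charmatrix.adjugate := by
  have hQ : Q.map C * A.charmatrix = A.charmatrix * Q.map C := by
    apply matPolyEquiv.injective
    rw [map_mul, map_mul, matPolyEquiv_map_C, matPolyEquiv_charmatrix, mul_sub, sub_mul, ← C_mul,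
      ← C_mul, h.eq, X_mul_C]
  have hsmul : A.charpoly • (Q.map C * A.charmatrix.adjugate) =
      A.charpoly • (A.charmatrix.adjugate * Q.map C) := by
    calc A.charpoly • (Q.map C * A.charmatrix.adjugate)
        = (A.charmatrix.adjugate * A.charmatrix) * (Q.map C * A.charmatrix.adjugate) := by
          rw [adjugate_mul, ← charpoly, smul_mul_assoc, one_mul]
      _ = A.charmatrix.adjugate * Q.map C * (A.charmatrix * A.charmatrix.adjugate) := by
          simp only [mul_assoc, ← mul_assoc A.charmatrix, ← hQ]
      _ = A.charpoly • (A.charmatrix.adjugate * Q.map C) := by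
          rw [mul_adjugate, ← charpoly, mul_smul_comm, mul_one]
  exact smul_right_injective _ A.charpoly_monic.ne_zero hsmul

theorem adjugate_charmatrix_apply_self_eq [IsDomain R] {A Q : Matrix n n R} (hQ : Qᵀ * Q = 1)
    (h : Commute Q A) {a b : n} (hab : Q *ᵥ Pi.single a 1 = Pi.single b 1) :
    A.charmatrix.adjugate a a = A.charmatrix.adjugate b b := by
  have hcol : Q.map C *ᵥ Pi.single a 1 = Pi.single b 1 := by
    ext1 i
    have := congrFun hab i
    simp only [mulVec_single_one, col_apply] at this
    simp [this, Pi.single_apply, apply_ite (C : R → R[X])]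
  have hconj : (Q.map C)ᵀ * A.charmatrix.adjugate * Q.map C = A.charmatrix.adjugate := by
    rw [mul_assoc, ← (commute_map_C_adjugate_charmatrix h).eq, ← mul_assoc, ← transpose_map,
      ← Matrix.map_mul, hQ]
    simp
  calc A.charmatrix.adjugate a a
      = Pi.single a 1 ⬝ᵥ
          (((Q.map C)ᵀ * A.charmatrix.adjugate * Q.map C) *ᵥ Pi.single a 1) := by
        rw [hconj]; simp
    _ = A.charmatrix.adjugate b b := by
        rw [← mulVec_mulVec, ← mulVec_mulVec, hcol, dotProduct_mulVec, vecMul_transpose, hcol]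
        simp

/-- If `u` is orthogonal to the cyclic subspace of a symmetric matrix `A` generated by `v`, then
some orthogonal involution commuting with `A` fixes `u` and negates `v`. -/
theorem exists_orthogonal_involution {A : Matrix n n ℝ} (hA : A.IsSymm) {u v : n → ℝ}
    (huv : ∀ k : ℕ, u ⬝ᵥ (A ^ k *ᵥ v) = 0) :
    ∃ Q : Matrix n n ℝ, Qᵀ * Q = 1 ∧ Commute Q A ∧ Q * Q = 1 ∧ Q *ᵥ u = u ∧ Q *ᵥ v = -v := by
  let Φ := toEuclideanCLM (n := n) (𝕜 := ℝ)
  let W : Submodule ℝ (EuclideanSpace ℝ n) :=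
    Submodule.span ℝ (Set.range fun k : ℕ => WithLp.toLp 2 (A ^ k *ᵥ v))
  let P := W.starProjection
  have hW : ∀ x ∈ W, Φ A x ∈ W := by
    intro x hx
    induction hx using Submodule.span_induction with
    | mem x hx =>
      obtain ⟨k, rfl⟩ := hx
      refine Submodule.subset_span ⟨k + 1, ?_⟩
      simp [Φ, toEuclideanCLM_toLp, pow_succ']
    | zero => simp
    | add x y _ _ hx hy => simpa using W.add_mem hx hy
    | smul c x _ hx => simpa using W.smul_mem c hx
  have hv : P (WithLp.toLp 2 v) = WithLp.toLp 2 v :=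
    Submodule.starProjection_eq_self_iff.mpr (Submodule.subset_span ⟨0, by simp⟩)
  have hu : P (WithLp.toLp 2 u) = 0 := by
    rw [Submodule.starProjection_apply_eq_zero_iff, Submodule.mem_orthogonal]
    intro x hx
    induction hx using Submodule.span_induction with
    | mem x hx =>
      obtain ⟨k, rfl⟩ := hx
      simpa [EuclideanSpace.inner_eq_star_dotProduct] using huv k
    | zero => simp
    | add x y _ _ hx hy => rw [inner_add_left, hx, hy, add_zero]
    | smul c x _ hx => rw [inner_smul_left, hx, mul_zero]
  have hPP : P * P = P := W.isIdempotentElem_starProjection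
  have hPs : star P = P := isSelfAdjoint_starProjection W
  have hAs : star (Φ A) = Φ A := by
    rw [← map_star, star_eq_conjTranspose, conjTranspose_eq_transpose_of_trivial, hA.eq]
  have hPAP : P * (Φ A * P) = Φ A * P := by
    ext1 x
    exact Submodule.starProjection_eq_self_iff.mpr (hW _ (W.starProjection_apply_mem x))
  have hPA : P * Φ A = Φ A * P := by
    have := congrArg star hPAP
    simp only [star_mul, hPs, hAs] at this
    rw [← this, mul_assoc, hPAP]
  obtain ⟨E, hE⟩ : ∃ E, Φ E = P := EquivLike.surjective Φ P
  have hEE : E * E = E := EquivLike.injective Φ (by rw [map_mul, hE, hPP])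
  have hEs : Eᵀ = E := by
    rw [← conjTranspose_eq_transpose_of_trivial, ← star_eq_conjTranspose]
    exact EquivLike.injective Φ (by rw [map_star, hE, hPs])
  have hEA : Commute E A := EquivLike.injective Φ (by rw [map_mul, map_mul, hE, hPA])
  have hEmul (w : n → ℝ) : E *ᵥ w = (P (WithLp.toLp 2 w)).ofLp := by
    rw [← hE, toEuclideanCLM_toLp]
  have hinv : (1 - 2 • E) * (1 - 2 • E) = 1 := by
    simp only [mul_sub, sub_mul, mul_one, one_mul, smul_mul_smul_comm, hEE]
    module
  refine ⟨1 - 2 • E, ?_, ?_, hinv, ?_, ?_⟩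
  · rwa [transpose_sub, transpose_smul, hEs, transpose_one]
  · exact (Commute.one_left A).sub_left (hEA.smul_left 2)
  · rw [sub_mulVec, smul_mulVec, hEmul, hu]; simp
  · rw [sub_mulVec, smul_mulVec, hEmul, hv, one_mulVec]
    module

theorem exists_orthogonal_involution_of_pow_apply_self_eq {A : Matrix n n ℝ} (hA : A.IsSymm)
    {a b : n} (h : ∀ k : ℕ, (A ^ k) a a = (A ^ k) b b) :
    ∃ Q : Matrix n n ℝ, Qᵀ * Q = 1 ∧ Commute Q A ∧ Q * Q = 1 ∧
      Q *ᵥ Pi.single a 1 = Pi.single b 1 := by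
  obtain ⟨Q, hQ, hQA, hQQ, hu, hv⟩ := exists_orthogonal_involution hA
    (u := Pi.single a 1 + Pi.single b 1) (v := Pi.single a 1 - Pi.single b 1) (by
      intro k
      have hsymm : (A ^ k) a b = (A ^ k) b a := (hA.pow k).apply b a
      simp [mulVec_sub, add_dotProduct, h k, hsymm, add_comm])
  refine ⟨Q, hQ, hQA, hQQ, ?_⟩
  rw [mulVec_add] at hu
  rw [mulVec_sub] at hv
  ext i
  have hui := congrFun hu i
  have hvi := congrFun hv i
  simp only [Pi.add_apply, Pi.sub_apply, Pi.neg_apply] at hui hvi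
  linarith

end Matrix

/-- Vertices `a` and `b` are cospectral iff there is an orthogonal symmetry `Q` of `X`
(an orthogonal matrix commuting with the adjacency matrix) with `Q² = I` and `Q e_a = e_b`. -/
theorem cospectral_iff_exists_orthogonal_symmetry {V : Type*} [Fintype V] [DecidableEq V]
    (X : SimpleGraph V) [DecidableRel X.Adj] (a b : V) :
    ((X.adjMatrix ℝ).submatrix (fun i : {x : V // x ≠ a} => (i : V))
          (fun i : {x : V // x ≠ a} => (i : V))).charpoly =
        ((X.adjMatrix ℝ).submatrix (fun i : {x : V // x ≠ b} => (i : V))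
          (fun i : {x : V // x ≠ b} => (i : V))).charpoly ↔
      ∃ Q : Matrix V V ℝ, Qᵀ * Q = 1 ∧ Q * X.adjMatrix ℝ = X.adjMatrix ℝ * Q ∧
        Q * Q = 1 ∧ Q *ᵥ Pi.single a 1 = Pi.single b 1 := by
  rw [Matrix.charpoly_submatrix_ne, Matrix.charpoly_submatrix_ne]
  constructor
  · intro h
    exact Matrix.exists_orthogonal_involution_of_pow_apply_self_eq (X.isSymm_adjMatrix (α := ℝ))
      (Matrix.pow_apply_self_eq_of_adjugate_charmatrix _ h)
  · rintro ⟨Q, hQ, hQA, -, hab⟩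
    exact Matrix.adjugate_charmatrix_apply_self_eq hQ hQA hab
end

section
/- Let X be a connected finite simple graph of diameter d with adjacency matrix A, and for 0 ≤ r ≤ d let A_r be the 0–1 matrix with (A_r)_{u,v} = 1 exactly when the graph distance between u and v is r (so A_0 = I and A_1 = A). Assume X is distance regular, i.e., for each r there is a real polynomial p_r of degree r with A_r = p_r(A). If a and b are distinct strongly cospectral vertices of X, then A_d is a permutation matrix satisfying A_d² = I and A_d e_a = e_b. -/
open Matrix BigOperators

/-- The 0–1 matrix whose `(u, v)` entry is `1` exactly when `u` and `v` are at distance `r`. -/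
noncomputable abbrev distMatrix {V : Type*} (X : SimpleGraph V) (r : ℕ) : Matrix V V ℝ :=
  Matrix.of fun u v : V => if X.dist u v = r then (1 : ℝ) else 0

/-- The matrices whose entries depend only on the distance between the two indices. -/
def distSubmodule {V : Type*} (X : SimpleGraph V) : Submodule ℝ (Matrix V V ℝ) where
  carrier := {M | ∃ f : ℕ → ℝ, ∀ u v, M u v = f (X.dist u v)}
  add_mem' := by
    rintro M N ⟨f, hf⟩ ⟨g, hg⟩
    exact ⟨f + g, fun u v => by simp [hf, hg]⟩
  zero_mem' := ⟨0, fun u v => rfl⟩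
  smul_mem' := by
    rintro c M ⟨f, hf⟩
    exact ⟨c • f, fun u v => by simp [hf]⟩

section Graph

variable {V : Type*} {X : SimpleGraph V}

theorem distMatrix_mem_distSubmodule (r : ℕ) : distMatrix X r ∈ distSubmodule X :=
  ⟨fun i => if i = r then 1 else 0, fun _ _ => rfl⟩

theorem apply_eq_of_mem_distSubmodule {M : Matrix V V ℝ} (hM : M ∈ distSubmodule X)
    {u v u' v' : V} (h : X.dist u v = X.dist u' v') : M u v = M u' v' := by
  obtain ⟨f, hf⟩ := hM
  rw [hf, hf, h]

theorem exists_eq_sum_distMatrix {d : ℕ} (hle : ∀ u v : V, X.dist u v ≤ d)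
    {M : Matrix V V ℝ} (hM : M ∈ distSubmodule X) :
    ∃ f : ℕ → ℝ, M = ∑ r ∈ Finset.range (d + 1), f r • distMatrix X r := by
  obtain ⟨f, hf⟩ := hM
  refine ⟨f, ?_⟩
  ext u v
  simp [Matrix.sum_apply, hf, hle u v]

/-- On a geodesic from `u` to `w`, the vertex before `w` is one step closer to `u`. -/
theorem SimpleGraph.Connected.exists_adj_dist_eq (hconn : X.Connected) {u w : V} {n : ℕ}
    (h : X.dist u w = n + 1) : ∃ v, X.Adj v w ∧ X.dist u v = n := by
  obtain ⟨p, hp⟩ := hconn.exists_walk_length_eq_dist w u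
  cases p with
  | nil => simp at h
  | @cons _ v _ hadj q =>
    refine ⟨v, hadj.symm, ?_⟩
    rw [SimpleGraph.Walk.length_cons, SimpleGraph.dist_comm, h] at hp
    have h1 := SimpleGraph.dist_le q
    have h2 := hconn.dist_triangle (u := u) (v := v) (w := w)
    rw [SimpleGraph.dist_eq_one_iff_adj.2 hadj.symm] at h2
    rw [SimpleGraph.dist_comm] at h1
    omega

theorem SimpleGraph.Connected.exists_dist_eq_of_le (hconn : X.Connected) {u : V} {n : ℕ}
    {w : V} (hw : X.dist u w = n) {i : ℕ} (hi : i ≤ n) : ∃ v, X.dist u v = i := by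
  induction n generalizing w with
  | zero => exact ⟨w, by omega⟩
  | succ n ih =>
    rcases hi.eq_or_lt with rfl | hlt
    · exact ⟨w, hw⟩
    · obtain ⟨v, -, hv⟩ := hconn.exists_adj_dist_eq hw
      exact ih hv (by omega)

theorem sum_distMatrix {d : ℕ} (hle : ∀ u v : V, X.dist u v ≤ d) :
    ∑ r ∈ Finset.range (d + 1), distMatrix X r = Matrix.of fun _ _ => 1 := by
  ext u v
  simp [Matrix.sum_apply, hle u v]

theorem distMatrix_mul_self_apply_self [Fintype V] (r : ℕ) (u : V) :
    (distMatrix X r * distMatrix X r) u u =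
      ((Finset.univ.filter fun v => X.dist u v = r).card : ℝ) := by
  simp only [distMatrix, Matrix.mul_apply, Matrix.of_apply, X.dist_comm (v := u)]
  simp [← ite_and]

end Graph

section DistanceRegular

open Polynomial

variable {V : Type*} [Fintype V] [DecidableEq V] {X : SimpleGraph V} [DecidableRel X.Adj] {d : ℕ}

theorem aeval_mem_distSubmodule_of_natDegree_le (hconn : X.Connected)
    (hdr : ∀ r : ℕ, r ≤ d → ∃ p : ℝ[X], p.natDegree = r ∧
      distMatrix X r = aeval (X.adjMatrix ℝ) p)
    {n : ℕ} (hn : n ≤ d) {q : ℝ[X]} (hq : q.natDegree ≤ n) :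
    aeval (X.adjMatrix ℝ) q ∈ distSubmodule X := by
  induction n generalizing q with
  | zero =>
    rw [eq_C_of_natDegree_le_zero hq, aeval_C, Algebra.algebraMap_eq_smul_one]
    refine Submodule.smul_mem _ _ ⟨fun i => if i = 0 then 1 else 0, fun u v => ?_⟩
    simp [Matrix.one_apply, hconn.dist_eq_zero_iff]
  | succ n ih =>
    obtain ⟨p, hp, hA⟩ := hdr (n + 1) hn
    have hlc : p.coeff (n + 1) ≠ 0 := by
      rw [← hp]
      exact leadingCoeff_ne_zero.2 (by rintro rfl; simp at hp)
    set c := q.coeff (n + 1) / p.coeff (n + 1) with hc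
    have hdeg : (q - c • p).natDegree ≤ n := by
      rw [natDegree_le_iff_coeff_eq_zero]
      intro N hN
      rcases (Nat.succ_le_of_lt hN).eq_or_lt with rfl | hlt
      · simp only [coeff_sub, coeff_smul, smul_eq_mul, hc, Nat.succ_eq_add_one]
        field_simp
        ring
      · simp [coeff_eq_zero_of_natDegree_lt (hq.trans_lt hlt),
          coeff_eq_zero_of_natDegree_lt (hp.trans_lt hlt)]
    have h := Submodule.add_mem _ (ih (by omega) hdeg)
      (Submodule.smul_mem _ c (distMatrix_mem_distSubmodule (X := X) (n + 1)))
    rwa [hA, ← map_smul, ← map_add, sub_add_cancel] at h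

theorem adjMatrix_mul_mem_distSubmodule (hconn : X.Connected)
    (hle : ∀ u v : V, X.dist u v ≤ d)
    (hdr : ∀ r : ℕ, r ≤ d → ∃ p : ℝ[X], p.natDegree = r ∧
      distMatrix X r = aeval (X.adjMatrix ℝ) p)
    {M : Matrix V V ℝ} (hM : M ∈ distSubmodule X) :
    X.adjMatrix ℝ * M ∈ distSubmodule X := by
  have hlt : ∀ r < d, X.adjMatrix ℝ * distMatrix X r ∈ distSubmodule X := by
    intro r hr
    obtain ⟨p, hp, hA⟩ := hdr r hr.le
    have h := aeval_mem_distSubmodule_of_natDegree_le hconn hdr (Nat.succ_le_of_lt hr)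
      (q := Polynomial.X * p) (natDegree_mul_le.trans (by rw [natDegree_X]; omega))
    rwa [map_mul, aeval_X, ← hA] at h
  -- The all-ones matrix is a polynomial in `A`, so it commutes with `A` and the graph is regular.
  have hJ : X.adjMatrix ℝ * (Matrix.of fun _ _ => 1) ∈ distSubmodule X := by
    have hcomm : Commute (X.adjMatrix ℝ) (Matrix.of fun _ _ => (1 : ℝ)) := by
      rw [← sum_distMatrix hle]
      refine Commute.sum_right _ _ _ fun r hr => ?_
      obtain ⟨p, -, hA⟩ := hdr r (Nat.lt_succ_iff.1 (Finset.mem_range.1 hr))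
      rw [hA]
      simpa using (Commute.all Polynomial.X p).map (aeval (R := ℝ) (X.adjMatrix ℝ))
    have hdeg : ∀ u v, X.degree u = X.degree v := fun u v => by
      simpa using congrFun (congrFun hcomm u) v
    obtain ⟨x⟩ := hconn.nonempty
    exact ⟨fun _ => X.degree x, fun u v => by simp [hdeg u x]⟩
  have hd : X.adjMatrix ℝ * distMatrix X d ∈ distSubmodule X := by
    rw [← sum_distMatrix hle, Finset.sum_range_succ, mul_add, Finset.mul_sum] at hJ
    exact (Submodule.add_mem_iff_right _ (Submodule.sum_mem _ fun r hr =>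
      hlt r (Finset.mem_range.1 hr))).1 hJ
  obtain ⟨f, rfl⟩ := exists_eq_sum_distMatrix hle hM
  rw [Finset.mul_sum]
  refine Submodule.sum_mem _ fun r hr => ?_
  rw [Matrix.mul_smul]
  refine Submodule.smul_mem _ _ ?_
  rcases (Nat.lt_succ_iff.1 (Finset.mem_range.1 hr)).eq_or_lt with rfl | h
  exacts [hd, hlt r h]

/-- The adjacency algebra of a distance-regular graph consists of distance matrices. -/
theorem aeval_mem_distSubmodule (hconn : X.Connected)
    (hle : ∀ u v : V, X.dist u v ≤ d)
    (hdr : ∀ r : ℕ, r ≤ d → ∃ p : ℝ[X], p.natDegree = r ∧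
      distMatrix X r = aeval (X.adjMatrix ℝ) p) (q : ℝ[X]) :
    aeval (X.adjMatrix ℝ) q ∈ distSubmodule X := by
  induction q using Polynomial.induction_on' with
  | add p q hp hq => rw [map_add]; exact Submodule.add_mem _ hp hq
  | monomial n c =>
    rw [aeval_monomial, ← Algebra.smul_def]
    refine Submodule.smul_mem _ _ ?_
    induction n with
    | zero =>
      simpa using aeval_mem_distSubmodule_of_natDegree_le hconn hdr d.zero_le
        (natDegree_one (R := ℝ)).le
    | succ n ih => rw [pow_succ']; exact adjMatrix_mul_mem_distSubmodule hconn hle hdr ih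

theorem distMatrix_mul_distMatrix_mem (hconn : X.Connected)
    (hle : ∀ u v : V, X.dist u v ≤ d)
    (hdr : ∀ r : ℕ, r ≤ d → ∃ p : ℝ[X], p.natDegree = r ∧
      distMatrix X r = aeval (X.adjMatrix ℝ) p) {r s : ℕ} (hr : r ≤ d) (hs : s ≤ d) :
    distMatrix X r * distMatrix X s ∈ distSubmodule X := by
  obtain ⟨p, -, hp⟩ := hdr r hr
  obtain ⟨q, -, hq⟩ := hdr s hs
  rw [hp, hq, ← map_mul]
  exact aeval_mem_distSubmodule hconn hle hdr _

theorem exists_dist_eq_of_le_diam (hconn : X.Connected)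
    (hle : ∀ u v : V, X.dist u v ≤ d) (hdiam : ∃ u v : V, X.dist u v = d)
    (hdr : ∀ r : ℕ, r ≤ d → ∃ p : ℝ[X], p.natDegree = r ∧
      distMatrix X r = aeval (X.adjMatrix ℝ) p) (u : V) {i : ℕ} (hi : i ≤ d) :
    ∃ v, X.dist u v = i := by
  obtain ⟨x, y, hxy⟩ := hdiam
  have h := apply_eq_of_mem_distSubmodule
    (distMatrix_mul_distMatrix_mem hconn hle hdr le_rfl le_rfl)
    (show X.dist u u = X.dist x x by simp)
  rw [distMatrix_mul_self_apply_self, distMatrix_mul_self_apply_self, Nat.cast_inj] at h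
  have hpos : 0 < (Finset.univ.filter fun v => X.dist u v = d).card := by
    rw [h]
    exact Finset.card_pos.2 ⟨y, by simpa using hxy⟩
  obtain ⟨w, hw⟩ := Finset.card_pos.1 hpos
  exact hconn.exists_dist_eq_of_le (Finset.mem_filter.1 hw).2 hi

/-- If `k ≠ 0` and each vertex has a unique vertex at distance `k`, then `k` is the diameter. -/
theorem eq_diam_of_existsUnique_dist_eq (hconn : X.Connected)
    (hle : ∀ u v : V, X.dist u v ≤ d) (hdiam : ∃ u v : V, X.dist u v = d)
    (hdr : ∀ r : ℕ, r ≤ d → ∃ p : ℝ[X], p.natDegree = r ∧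
      distMatrix X r = aeval (X.adjMatrix ℝ) p) {k : ℕ} (hk : k ≠ 0) (hkd : k ≤ d)
    (huniq : ∀ u, ∃! v, X.dist u v = k) : k = d := by
  by_contra hne
  have b := hdiam.choose
  obtain ⟨a, ha, ha'⟩ := huniq b
  obtain ⟨w, hw⟩ := exists_dist_eq_of_le_diam hconn hle hdiam hdr b (i := k + 1) (by omega)
  obtain ⟨v, hvw, hv⟩ := hconn.exists_adj_dist_eq hw
  obtain rfl := ha' v hv
  obtain ⟨j, rfl⟩ := Nat.exists_eq_succ_of_ne_zero hk
  obtain ⟨z, hzv, hz⟩ := hconn.exists_adj_dist_eq ha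
  have h := apply_eq_of_mem_distSubmodule
    (distMatrix_mul_distMatrix_mem hconn hle hdr hkd (show j + 1 + 1 ≤ d by omega))
    (show X.dist v w = X.dist v z by
      rw [SimpleGraph.dist_eq_one_iff_adj.2 hvw, SimpleGraph.dist_eq_one_iff_adj.2 hzv.symm])
  have hvb : X.dist v b = j + 1 := by rw [X.dist_comm]; exact hv
  have hrow : ∀ y, (distMatrix X (j + 1) * distMatrix X (j + 1 + 1)) v y =
      distMatrix X (j + 1 + 1) b y := by
    intro y
    rw [Matrix.mul_apply, Finset.sum_eq_single b]
    · simp [hvb]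
    · intro x _ hxb
      have hvx : X.dist v x ≠ j + 1 := fun hx => hxb ((huniq v).unique hx hvb)
      simp [hvx]
    · simp
  rw [hrow, hrow] at h
  simp [hw, hz] at h
  omega

end DistanceRegular

section SpectralDecomposition

open Polynomial

variable {V : Type*} [Fintype V] [DecidableEq V] {A : Matrix V V ℝ} {m : ℕ} {θ : Fin m → ℝ}
  {E : Fin m → Matrix V V ℝ}

theorem IsSpectralDecomp.sum_smul_mul_sum_smul (h : IsSpectralDecomp A θ E) (f g : Fin m → ℝ) :
    (∑ r, f r • E r) * (∑ r, g r • E r) = ∑ r, (f r * g r) • E r := by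
  rw [Finset.sum_mul]
  refine Finset.sum_congr rfl fun r _ => ?_
  rw [Finset.mul_sum, Finset.sum_eq_single r]
  · rw [smul_mul_smul_comm, h.idem]
  · intro s _ hs
    rw [smul_mul_smul_comm, h.mul_eq_zero r s hs.symm, smul_zero]
  · simp

theorem IsSpectralDecomp.aeval_eq (h : IsSpectralDecomp A θ E) (q : ℝ[X]) :
    aeval A q = ∑ r, q.eval (θ r) • E r := by
  induction q using Polynomial.induction_on' with
  | add p q hp hq => simp [hp, hq, add_smul, Finset.sum_add_distrib]
  | monomial n c =>
    have hpow : A ^ n = ∑ r, θ r ^ n • E r := by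
      induction n with
      | zero => simp [h.sum_eq_one]
      | succ n ih =>
        rw [pow_succ, ih]
        conv_lhs => rw [h.eq_sum]
        rw [h.sum_smul_mul_sum_smul]
        simp [pow_succ]
    rw [aeval_monomial, ← Algebra.smul_def, hpow, Finset.smul_sum]
    simp [mul_smul]

theorem IsSpectralDecomp.exists_aeval_eq (h : IsSpectralDecomp A θ E) (f : Fin m → ℝ) :
    ∃ q : ℝ[X], aeval A q = ∑ r, f r • E r := by
  refine ⟨Lagrange.interpolate Finset.univ θ f, ?_⟩
  rw [h.aeval_eq]
  refine Finset.sum_congr rfl fun r hr => ?_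
  rw [Lagrange.eval_interpolate_at_node f h.theta_inj.injOn hr]

/-- Strongly cospectral vertices are exchanged by an involution in the algebra generated by `A`. -/
theorem IsSpectralDecomp.exists_aeval_involution (h : IsSpectralDecomp A θ E) {a b : V}
    (hsc : ∀ r, E r *ᵥ Pi.single a 1 = E r *ᵥ Pi.single b 1 ∨
        E r *ᵥ Pi.single a 1 = -(E r *ᵥ Pi.single b 1)) :
    ∃ q : ℝ[X], aeval A q * aeval A q = 1 ∧ aeval A q *ᵥ Pi.single b 1 = Pi.single a 1 := by
  have hsign : ∀ r, ∃ c : ℝ, c * c = 1 ∧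
      c • (E r *ᵥ Pi.single b 1) = E r *ᵥ Pi.single a 1 := by
    intro r
    rcases hsc r with hr | hr
    · exact ⟨1, by simp, by simp [hr]⟩
    · exact ⟨-1, by simp, by simp only [hr, neg_smul, one_smul]⟩
  choose c hc hcE using hsign
  obtain ⟨q, hq⟩ := h.exists_aeval_eq c
  refine ⟨q, ?_, ?_⟩
  · rw [hq, h.sum_smul_mul_sum_smul]
    simp [hc, h.sum_eq_one]
  · rw [hq, Matrix.sum_mulVec]
    simp only [Matrix.smul_mulVec, hcE]
    rw [← Matrix.sum_mulVec, h.sum_eq_one, Matrix.one_mulVec]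

end SpectralDecomposition

/-- In a distance-regular graph of diameter `d`, if `a ≠ b` are strongly cospectral then
the distance-`d` matrix `A_d` is a permutation matrix of order two with `A_d e_a = e_b`. -/
theorem distanceRegular_stronglyCospectral {V : Type*} [Fintype V] [DecidableEq V]
    (X : SimpleGraph V) [DecidableRel X.Adj] (hconn : X.Connected) (d : ℕ)
    (hle : ∀ u v : V, X.dist u v ≤ d) (hdiam : ∃ u v : V, X.dist u v = d)
    (hdr : ∀ r : ℕ, r ≤ d → ∃ p : Polynomial ℝ, p.natDegree = r ∧
      (Matrix.of fun u v : V => if X.dist u v = r then (1 : ℝ) else 0) =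
        Polynomial.aeval (X.adjMatrix ℝ) p)
    {m : ℕ} (θ : Fin m → ℝ) (E : Fin m → Matrix V V ℝ)
    (hdec : IsSpectralDecomp (X.adjMatrix ℝ) θ E) (a b : V) (hab : a ≠ b)
    (hsc : ∀ r, E r *ᵥ Pi.single a 1 = E r *ᵥ Pi.single b 1 ∨
        E r *ᵥ Pi.single a 1 = -(E r *ᵥ Pi.single b 1)) :
    (∃ σ : Equiv.Perm V, ∀ u v : V,
        (Matrix.of fun u v : V => if X.dist u v = d then (1 : ℝ) else 0) u v =
          if σ u = v then 1 else 0) ∧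
      (Matrix.of fun u v : V => if X.dist u v = d then (1 : ℝ) else 0) *
          (Matrix.of fun u v : V => if X.dist u v = d then (1 : ℝ) else 0) = 1 ∧
      (Matrix.of fun u v : V => if X.dist u v = d then (1 : ℝ) else 0) *ᵥ Pi.single a 1 =
        Pi.single b 1 := by
  obtain ⟨q, hsq, hqb⟩ := hdec.exists_aeval_involution hsc
  obtain ⟨f, hf⟩ := aeval_mem_distSubmodule hconn hle hdr q
  have hcol : ∀ u, f (X.dist u b) = if u = a then 1 else 0 := by
    intro u
    have := congrFun hqb u
    rwa [Matrix.mulVec_single_one, Matrix.col_apply, hf, Pi.single_apply] at this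
  have hS : Polynomial.aeval (X.adjMatrix ℝ) q = distMatrix X (X.dist a b) := by
    ext u v
    obtain ⟨w, hw⟩ := exists_dist_eq_of_le_diam hconn hle hdiam hdr b (hle u v)
    have hfw := hcol w
    rw [X.dist_comm, hw] at hfw
    rw [hf, hfw, distMatrix, Matrix.of_apply, ← hw, X.dist_comm (u := a)]
    by_cases hwa : w = a
    · simp [hwa]
    · have hne : X.dist b w ≠ X.dist b a := by
        intro h
        have h1 := hcol w
        have h2 := hcol a
        rw [X.dist_comm, h, X.dist_comm, h2] at h1
        simp [hwa] at h1
      simp [hwa, hne]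
  have huniq : ∀ u, ∃! v, X.dist u v = X.dist a b := by
    intro u
    have h := congrFun (congrFun hsq u) u
    rw [hS, distMatrix_mul_self_apply_self, Matrix.one_apply_eq, Nat.cast_eq_one,
      Finset.card_eq_one] at h
    obtain ⟨v, hv⟩ := h
    have hmem : ∀ w, X.dist u w = X.dist a b ↔ w = v := fun w => by
      simpa using Finset.ext_iff.1 hv w
    exact ⟨v, (hmem v).2 rfl, fun w hw => (hmem w).1 hw⟩
  obtain hk := eq_diam_of_existsUnique_dist_eq hconn hle hdiam hdr
    (hconn.pos_dist_of_ne hab).ne' (hle a b) huniq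
  rw [hk] at hS huniq
  rw [hS] at hsq hqb
  refine ⟨?_, hsq, ?_⟩
  · choose g hg hg' using huniq
    have hinv : Function.Involutive g := fun u =>
      (hg' (g u) u (by simpa [X.dist_comm] using hg u)).symm
    refine ⟨hinv.toPerm, fun u v => ?_⟩
    have hiff : X.dist u v = d ↔ g u = v := ⟨fun h => (hg' u v h).symm, fun h => h ▸ hg u⟩
    by_cases h : g u = v
    · simp [h, hiff.2 h]
    · simp [h, mt hiff.1 h]
  · rw [← hqb, Matrix.mulVec_mulVec, hsq, Matrix.one_mulVec]
end
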